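/- arXiv:0901.1652 — 2 statements merged into one kernel-verified Lean document; each statement's English description precedes it below -/
import Mathlib

section
/- Exponential bound on nearest-neighbor fluctuations: for every β > 0, ε > 0, L ≥ 2 and every 0 < γ < 1: (i) for any nearest-neighbor pair (x,y), ⟨e^{βγ(B_{xy} − 1)}⟩ₜₛ ≤ (1 − γ)^{-1}; (ii) for any n pairwise distinct nearest-neighbor pairs (x₁,y₁), …, (xₙ,yₙ), ⟨e^{βγ Σ_{j=1}^n (B_{x_j y_j} − 1)}⟩ₜₛ ≤ (1 − γ)^{-n}. -/
open scoped BigOperators Classical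
open MeasureTheory

noncomputable section

/-- The 3-dimensional discrete torus of side `L`. -/
abbrev Torus (L : ℕ) := Fin 3 → ZMod L

/-- The unit vector in direction `i`. -/
def unitVec (L : ℕ) (i : Fin 3) : Torus L := fun j => if j = i then 1 else 0

/-- Nearest-neighbor relation on the torus. -/
def NN {L : ℕ} (x y : Torus L) : Prop :=
  x ≠ y ∧ ∃ i : Fin 3, y = x + unitVec L i ∨ y = x - unitVec L i

/-- Periodic (Euclidean) distance on the torus. -/
def torusDist {L : ℕ} (x y : Torus L) : ℝ :=
  Real.sqrt (∑ i : Fin 3, (min ((x i - y i).val) (L - (x i - y i).val) : ℝ) ^ 2)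

variable {L : ℕ}

/-- Sum of a (symmetric) function over unordered nearest-neighbor pairs. -/
def nnSum [NeZero L] (f : Torus L → Torus L → ℝ) : ℝ :=
  (1 / 2) * ∑ x : Torus L, ∑ y : Torus L, if NN x y then f x y else 0

/-- The matrix of the operator `D_{β,ε}(t)`, the symmetric operator on `ℝ^Λ` with
quadratic form `β ∑_{NN (ij)} e^{t_i+t_j}(v_i-v_j)² + ε ∑_k e^{t_k} v_k²`. -/
def Dmat [NeZero L] (β ε : ℝ) (t : Torus L → ℝ) : Matrix (Torus L) (Torus L) ℝ :=
  Matrix.of fun j k =>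
    if j = k then
      β * (∑ i : Torus L, if NN i j then Real.exp (t i + t j) else 0) + ε * Real.exp (t j)
    else if NN j k then -(β * Real.exp (t j + t k)) else 0

/-- The free energy (effective action) `F_{β,ε}(t)`. -/
def freeEnergy [NeZero L] (β ε : ℝ) (t : Torus L → ℝ) : ℝ :=
  β * nnSum (fun i j => Real.cosh (t i - t j) - 1)
    - (1 / 2) * Real.log (Dmat β ε t).det
    + ∑ k : Torus L, (t k - ε + ε * Real.cosh (t k))

/-- The expectation `⟨f⟩ = ∫ f(t) e^{-F_{β,ε}(t)} ∏ dt_k/√(2π)`. -/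
def expect [NeZero L] (β ε : ℝ) (f : (Torus L → ℝ) → ℝ) : ℝ :=
  ∫ t : Torus L → ℝ,
    f t * Real.exp (-(freeEnergy β ε t)) *
      ((Real.sqrt (2 * Real.pi))⁻¹) ^ (Fintype.card (Torus L))

/-- `B_{xy} = cosh(t_x - t_y) + (1/2)(s_x - s_y)² e^{t_x+t_y}`. -/
def Bq {L : ℕ} (t s : Torus L → ℝ) (x y : Torus L) : ℝ :=
  Real.cosh (t x - t y) + (1 / 2) * (s x - s y) ^ 2 * Real.exp (t x + t y)

/-- `z^b_k = cosh t_k + (1/2) s_k² e^{t_k}`. -/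
def zb {L : ℕ} (t s : Torus L → ℝ) (k : Torus L) : ℝ :=
  Real.cosh (t k) + (1 / 2) * (s k) ^ 2 * Real.exp (t k)

/-- The `(t,s)`-expectation of the `H^{2|2}` model after integrating out the
Grassmann fields. -/
def tsExpect [NeZero L] (β ε : ℝ) (g : (Torus L → ℝ) → (Torus L → ℝ) → ℝ) : ℝ :=
  ∫ p : (Torus L → ℝ) × (Torus L → ℝ),
    g p.1 p.2 * (Dmat β ε p.1).det *
      Real.exp (-(β * nnSum (fun i j => Bq p.1 p.2 i j - 1))
        - ε * ∑ k : Torus L, (zb p.1 p.2 k - 1)) *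
      (∏ k : Torus L, Real.exp (-(p.1 k))) * ((2 * Real.pi)⁻¹) ^ (Fintype.card (Torus L))

/-- The coordinate unit vector `δ_x`. -/
def delta {L : ℕ} (x : Torus L) : Torus L → ℝ := fun j => if j = x then 1 else 0

/-- `[u ; G v] = ∑_{a,b} u_a G_{ab} v_b`. -/
def qform [NeZero L] (G : Matrix (Torus L) (Torus L) ℝ) (u v : Torus L → ℝ) : ℝ :=
  ∑ a : Torus L, ∑ b : Torus L, u a * G a b * v b


lemma gauss_lint : ∫⁻ x : ℝ, ENNReal.ofReal (Real.exp (-(1/2) * x^2)) = ENNReal.ofReal √(2*Real.pi) := by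
  rw [← ofReal_integral_eq_lintegral_ofReal (integrable_exp_neg_mul_sq (by norm_num))
    (Filter.Eventually.of_forall fun x => (Real.exp_pos _).le), integral_gaussian]
  congr 2; ring

lemma gig (q : ℝ) (hq : 0 < q) :
    ∫⁻ c in Set.Ioi (0:ℝ), ENNReal.ofReal ((√c)⁻¹ * Real.exp (-(1/2)*(c+q^2/c) + q)) ≤
      ENNReal.ofReal √(2*Real.pi) := by
  set g : ℝ → ENNReal := fun x => ENNReal.ofReal (Real.exp (-(1/2) * x^2)) with hg
  set φ : ℝ → ℝ := fun c => √c - q/√c with hφ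
  have hgm : Measurable g := by fun_prop
  have hφm : Measurable φ := by fun_prop
  have h1 : ∫⁻ c in Set.Ioi (0:ℝ), ENNReal.ofReal ((√c)⁻¹ * Real.exp (-(1/2)*(c+q^2/c) + q))
      = ∫⁻ c in Set.Ioi (0:ℝ), ENNReal.ofReal ((√c)⁻¹) * g (φ c) := by
    refine setLIntegral_congr_fun measurableSet_Ioi fun c hc => ?_
    have hc : 0 < c := hc
    have hs : 0 < √c := Real.sqrt_pos.2 hc
    simp only [hg, hφ]
    rw [ENNReal.ofReal_mul (by positivity)]
    congr 3
    obtain ⟨r, hr, rfl⟩ : ∃ r, 0 < r ∧ c = r^2 := ⟨√c, hs, (Real.sq_sqrt hc.le).symm⟩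
    rw [Real.sqrt_sq hr.le]
    field_simp; ring
  have h2 : ∫⁻ c in Set.Ioi (0:ℝ), ENNReal.ofReal ((√c)⁻¹) * g (φ c) =
      ∫⁻ c in Set.Ioi (0:ℝ), ENNReal.ofReal (q/(c*√c)) * g (φ c) := by
    have him : (fun c:ℝ => q^2/c) '' Set.Ioi 0 = Set.Ioi 0 := by
      ext x; constructor
      · rintro ⟨c, hc, rfl⟩; have hc : 0 < c := hc; show 0 < q^2/c; positivity
      · intro hx; have hx : 0 < x := hx
        exact ⟨q^2/x, by show 0 < q^2/x; positivity, by field_simp⟩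
    have key := lintegral_image_eq_lintegral_abs_deriv_mul (s := Set.Ioi (0:ℝ)) (f := fun c:ℝ => q^2/c)
      (f' := fun c => -(q^2/c^2)) measurableSet_Ioi
      (fun c hc => by
        have hc : 0 < c := hc
        have := ((hasDerivAt_id c).inv hc.ne').const_mul (q^2)
        refine HasDerivAt.hasDerivWithinAt ?_
        convert! this using 1
        simp; ring)
      (fun a ha b hb h => by
        have ha : 0 < a := ha
        have hb : 0 < b := hb
        field_simp at h; exact h.symm) (fun c => ENNReal.ofReal ((√c)⁻¹) * g (φ c))
    rw [him] at key
    rw [key]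
    refine setLIntegral_congr_fun measurableSet_Ioi fun c hc => ?_
    have hc : 0 < c := hc
    have hs : 0 < √c := Real.sqrt_pos.2 hc
    obtain ⟨r, hr, rfl⟩ : ∃ r, 0 < r ∧ c = r^2 := ⟨√c, hs, (Real.sq_sqrt hc.le).symm⟩
    have e1 : √(q^2/r^2) = q/r := by rw [← div_pow, Real.sqrt_sq (by positivity)]
    simp only [hg, hφ]
    rw [e1, Real.sqrt_sq hr.le, ← mul_assoc, ← ENNReal.ofReal_mul (abs_nonneg _), abs_neg, abs_of_pos (by positivity)]
    congr 2
    · field_simp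
    · congr 2; field_simp; ring
  have h3 : (∫⁻ c in Set.Ioi (0:ℝ), ENNReal.ofReal ((√c)⁻¹) * g (φ c)) +
      ∫⁻ c in Set.Ioi (0:ℝ), ENNReal.ofReal (q/(c*√c)) * g (φ c) ≤ 2 * ENNReal.ofReal √(2*Real.pi) := by
    rw [← lintegral_add_left (by fun_prop), ← gauss_lint]
    have key := lintegral_image_eq_lintegral_abs_deriv_mul (s := Set.Ioi (0:ℝ)) (f := φ)
      (f' := fun c => 1/(2*√c) + q/(2*(c*√c))) measurableSet_Ioi
      (fun c hc => by
        have hc : 0 < c := hc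
        have hs : 0 < √c := Real.sqrt_pos.2 hc
        have h0 := (hasDerivAt_id c).sqrt hc.ne'
        have := h0.sub ((h0.inv hs.ne').const_mul q)
        refine HasDerivAt.hasDerivWithinAt ?_
        convert! this using 1
        obtain ⟨r, hr, rfl⟩ : ∃ r, 0 < r ∧ c = r^2 := ⟨√c, hs, (Real.sq_sqrt hc.le).symm⟩
        simp only [id, Real.sqrt_sq hr.le]
        field_simp; ring)
      (by
        refine StrictMonoOn.injOn fun a ha b hb h => ?_
        have ha : 0 < a := ha
        have hs : 0 < √a := Real.sqrt_pos.2 ha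
        have : √a < √b := Real.sqrt_lt_sqrt ha.le h
        have : q/√b < q/√a := by gcongr
        simp only [hφ]; linarith) g
    calc _ = ∫⁻ c in Set.Ioi (0:ℝ), 2 * (ENNReal.ofReal |1/(2*√c) + q/(2*(c*√c))| * g (φ c)) := by
          refine setLIntegral_congr_fun measurableSet_Ioi fun c hc => ?_
          have hc : 0 < c := hc
          have hs : 0 < √c := Real.sqrt_pos.2 hc
          rw [← add_mul, ← ENNReal.ofReal_add (by positivity) (by positivity), ← mul_assoc]
          congr 1
          rw [show (2:ENNReal) = ENNReal.ofReal 2 by simp, ← ENNReal.ofReal_mul (by norm_num), abs_of_pos (by positivity)]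
          congr 1
          field_simp
      _ = 2 * ∫⁻ c in φ '' Set.Ioi 0, g c := by
          rw [lintegral_const_mul' _ _ (by simp), key]
      _ ≤ _ := by gcongr; exact Measure.restrict_le_self
  rw [h1]
  rw [← h2, ← two_mul] at h3
  exact (ENNReal.mul_le_mul_iff_right (by simp) (by simp)).1 h3

open Matrix in
lemma mmat_inv_nonneg {V : Type*} [Fintype V] [DecidableEq V] (A : Matrix V V ℝ) (hA : A.PosDef)
    (hoff : ∀ i j, i ≠ j → A i j ≤ 0) (η : V → ℝ) (hη : ∀ i, 0 ≤ η i) (i : V) :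
    0 ≤ (A⁻¹ *ᵥ η) i := by
  set z := A⁻¹ *ᵥ η with hz
  have hAz : A *ᵥ z = η := by
    rw [hz, mulVec_mulVec, mul_nonsing_inv _ (by exact hA.det_pos.ne'.isUnit), one_mulVec]
  set m : V → ℝ := fun i => max (-z i) 0 with hm
  set p : V → ℝ := fun i => max (z i) 0 with hp
  have hzpm : z = p - m := by
    ext i; simp only [hp, hm, Pi.sub_apply]
    rcases le_total (z i) 0 with h | h <;> simp [h]
  have h1 : 0 ≤ m ⬝ᵥ (A *ᵥ z) := by
    rw [hAz]; exact Finset.sum_nonneg fun i _ => mul_nonneg (le_max_right _ _) (hη i)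
  have h2 : m ⬝ᵥ (A *ᵥ p) ≤ 0 := by
    refine Finset.sum_nonpos fun i _ => ?_
    simp only [mulVec, dotProduct, Finset.mul_sum]
    refine Finset.sum_nonpos fun j _ => ?_
    have m0 : 0 ≤ m i := le_max_right _ _
    have p0 : 0 ≤ p j := le_max_right _ _
    by_cases hij : i = j
    · subst hij
      have : m i * p i = 0 := by
        simp only [hp, hm]
        rcases le_total (z i) 0 with h | h <;> simp [h]
      rw [show m i * (A i i * p i) = A i i * (m i * p i) by ring, this, mul_zero]
    · exact mul_nonpos_of_nonneg_of_nonpos m0 (mul_nonpos_of_nonpos_of_nonneg (hoff i j hij) p0)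
  rw [hzpm, mulVec_sub, dotProduct_sub] at h1
  have hm0 : m = 0 := by
    by_contra hne
    have := hA.dotProduct_mulVec_pos hne
    simp only [star_trivial] at this
    linarith
  have := congrFun hm0 i
  simp only [hm, Pi.zero_apply] at this
  have := le_max_left (-z i) 0
  linarith

open Matrix in
lemma inv_mulVec_eq {V : Type*} [Fintype V] [DecidableEq V] (A : Matrix V V ℝ) (hA : A.PosDef)
    (z η : V → ℝ) (h : A *ᵥ z = η) : A⁻¹ *ᵥ η = z := by
  rw [← h, mulVec_mulVec, nonsing_inv_mul _ (by exact hA.det_pos.ne'.isUnit), one_mulVec]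

/-- block matrix -/
def blk {V : Type*} (A : Matrix V V ℝ) (w : V → ℝ) (d : ℝ) : Matrix (V ⊕ Unit) (V ⊕ Unit) ℝ :=
  Matrix.fromBlocks A (Matrix.of fun i _ => -w i) (Matrix.of fun _ j => -w j) (Matrix.of fun _ _ => d)

open Matrix in
lemma blk_props {V : Type*} [Fintype V] [DecidableEq V] (A : Matrix V V ℝ) (w : V → ℝ) (d : ℝ)
    (hH : (blk A w d).PosDef) :
    A.PosDef ∧ 0 < d - w ⬝ᵥ (A⁻¹ *ᵥ w) ∧ (blk A w d).det = A.det * (d - w ⬝ᵥ (A⁻¹ *ᵥ w)) ∧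
    ∀ (η : V → ℝ) (η0 : ℝ), 
      (Sum.elim η (fun _ => η0)) ⬝ᵥ ((blk A w d)⁻¹ *ᵥ (Sum.elim η (fun _ => η0))) =
        η ⬝ᵥ (A⁻¹ *ᵥ η) + (η0 + w ⬝ᵥ (A⁻¹ *ᵥ η))^2 / (d - w ⬝ᵥ (A⁻¹ *ᵥ w)) := by
  have hA : A.PosDef := by
    have := hH.submatrix (e := Sum.inl) Sum.inl_injective
    convert! this using 1
  have hdet : (blk A w d).det = A.det * (d - w ⬝ᵥ (A⁻¹ *ᵥ w)) := by
    have := A.invertibleOfIsUnitDet hA.det_pos.ne'.isUnit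
    rw [blk, det_fromBlocks₁₁, Matrix.invOf_eq_nonsing_inv]
    congr 1
    rw [det_unique]
    simp only [Matrix.sub_apply, of_apply, mul_apply, dotProduct, mulVec, Finset.mul_sum, Finset.sum_mul]
    congr 1
    rw [Finset.sum_comm]
    refine Finset.sum_congr rfl fun i _ => Finset.sum_congr rfl fun j _ => by ring
  have hc : 0 < d - w ⬝ᵥ (A⁻¹ *ᵥ w) := by
    have := hH.det_pos
    rw [hdet] at this
    exact (pos_iff_pos_of_mul_pos this).1 hA.det_pos
  refine ⟨hA, hc, hdet, fun η η0 => ?_⟩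
  set c := d - w ⬝ᵥ (A⁻¹ *ᵥ w) with hcd
  set q := η0 + w ⬝ᵥ (A⁻¹ *ᵥ η) with hq
  have hu : A * A⁻¹ = 1 := mul_nonsing_inv _ hA.det_pos.ne'.isUnit
  have hsym : η ⬝ᵥ (A⁻¹ *ᵥ w) = w ⬝ᵥ (A⁻¹ *ᵥ η) := by
    have hT : (A⁻¹)ᵀ = A⁻¹ := by
      have := hA.inv.isHermitian
      simpa [IsHermitian, conjTranspose_eq_transpose_of_trivial] using this
    rw [dotProduct_mulVec, ← mulVec_transpose, hT, dotProduct_comm]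
  have hz : (blk A w d)⁻¹ *ᵥ (Sum.elim η (fun _ => η0)) =
      Sum.elim (A⁻¹ *ᵥ η + (q/c) • (A⁻¹ *ᵥ w)) (fun _ => q/c) := by
    refine inv_mulVec_eq _ hH _ _ ?_
    rw [blk, fromBlocks_mulVec]
    congr 1
    · simp only [Sum.elim_comp_inl, Sum.elim_comp_inr, mulVec_add, mulVec_smul, mulVec_mulVec, hu, one_mulVec]
      ext i; simp [mulVec, dotProduct]; ring
    · ext i
      have : (of fun (_:Unit) j => -w j) *ᵥ (A⁻¹ *ᵥ η + (q/c) • (A⁻¹ *ᵥ w)) = 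
        fun _ => -(w ⬝ᵥ (A⁻¹ *ᵥ η) + (q/c) * (w ⬝ᵥ (A⁻¹ *ᵥ w))) := by
        ext i
        rw [← smul_eq_mul, ← dotProduct_smul, ← dotProduct_add, ← neg_dotProduct]
        rfl
      simp only [Sum.elim_comp_inl, Sum.elim_comp_inr, Pi.add_apply, this]
      have e1 : w ⬝ᵥ (A⁻¹ *ᵥ η) = q - η0 := by rw [hq]; ring
      have e2 : w ⬝ᵥ (A⁻¹ *ᵥ w) = d - c := by rw [hcd]; ring
      rw [e1, e2]
      simp [mulVec, dotProduct]
      field_simp; ring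
  rw [hz, sumElim_dotProduct_sumElim, dotProduct_add, dotProduct_smul, hsym]
  simp only [dotProduct, Finset.univ_unique, Finset.sum_singleton, smul_eq_mul]
  rw [show ∑ i, w i * (A⁻¹ *ᵥ η) i = w ⬝ᵥ (A⁻¹ *ᵥ η) from rfl]
  have e1 : w ⬝ᵥ (A⁻¹ *ᵥ η) = q - η0 := by rw [hq]; ring
  rw [e1]; field_simp; ring

open Matrix in
/-- The density of the random Schrodinger potential. -/
def Gd {V : Type*} [Fintype V] [DecidableEq V] (W : Matrix V V ℝ) (η : V → ℝ) (b : V → ℝ) : ENNReal :=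
  if (diagonal b - W).PosDef then
    ENNReal.ofReal ((√((diagonal b - W).det))⁻¹ *
      Real.exp (-(1/2) * ∑ i, ∑ j, (diagonal b - W) i j
        - (1/2) * (η ⬝ᵥ ((diagonal b - W)⁻¹ *ᵥ η)) + ∑ i, η i))
  else 0

def GdBound (V : Type) [Fintype V] [DecidableEq V] : Prop :=
  ∀ (W : Matrix V V ℝ) (η : V → ℝ), W.IsSymm → (∀ i j, 0 ≤ W i j) → (∀ i, 0 < η i) →
    ∫⁻ b : V → ℝ, Gd W η b ≤ (ENNReal.ofReal √(2*Real.pi)) ^ (Fintype.card V)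

open Matrix in
lemma GdBound_equiv {V V' : Type} [Fintype V] [DecidableEq V] [Fintype V'] [DecidableEq V']
    (e : V ≃ V') (h : GdBound V) : GdBound V' := by
  intro W η hW h0 hη
  have := h (W.submatrix e e) (η ∘ e) (hW.submatrix e) (fun i j => h0 _ _) (fun i => hη _)
  rw [Fintype.card_congr e] at this
  refine le_trans (le_of_eq ?_) this
  rw [(volume_measurePreserving_piCongrLeft (fun _ : V' => ℝ) e).lintegral_map_equiv]
  refine lintegral_congr fun b => ?_
  have hb : ∀ i, (MeasurableEquiv.piCongrLeft (fun _ : V' => ℝ) e b) (e i) = b i := fun i => by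
    simp [MeasurableEquiv.coe_piCongrLeft, Equiv.piCongrLeft_apply_apply]
  set b' := MeasurableEquiv.piCongrLeft (fun _ : V' => ℝ) e b
  have hm : diagonal b - W.submatrix e e = (diagonal b' - W).submatrix e e := by
    ext i j
    simp [diagonal_apply, hb]
  unfold Gd
  rw [hm]
  have hpd : ((diagonal b' - W).submatrix e e).PosDef ↔ (diagonal b' - W).PosDef := by
    constructor
    · intro h
      have := h.submatrix (e := e.symm) e.symm.injective
      simpa using this
    · intro h; exact h.submatrix e.injective
  simp only [hpd, det_submatrix_equiv_self, inv_submatrix_equiv, submatrix_mulVec_equiv]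
  congr 5
  · congr 1
    · congr 1
      rw [← Equiv.sum_comp e]
      refine Finset.sum_congr rfl fun i _ => ?_
      rw [← Equiv.sum_comp e]; rfl
    · congr 1
      rw [show (η ∘ e) ∘ e.symm = η by ext; simp]
      simp only [dotProduct]
      rw [← Equiv.sum_comp e]; rfl
  · rw [← Equiv.sum_comp e]; rfl

open Matrix in
lemma GdBound_succ {V : Type} [Fintype V] [DecidableEq V] (h : GdBound V) : GdBound (V ⊕ Unit) := by
  intro W η hW h0 hη
  set W' : Matrix V V ℝ := W.submatrix Sum.inl Sum.inl with hW'
  set w : V → ℝ := fun i => W (Sum.inl i) (Sum.inr ()) with hw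
  set η' : V → ℝ := η ∘ Sum.inl with hη'
  set η0 : ℝ := η (Sum.inr ()) with hη0
  set w0 : ℝ := W (Sum.inr ()) (Sum.inr ()) with hw0
  have ih := h W' (η' + w) (hW.submatrix _) (fun i j => h0 _ _) 
    (fun i => add_pos_of_pos_of_nonneg (hη _) (h0 _ _))
  rw [(volume_measurePreserving_sumPiEquivProdPi_symm (fun _ : V ⊕ Unit => ℝ)).lintegral_map_equiv]
  refine (lintegral_prod_le _).trans ?_
  rw [Fintype.card_sum, Fintype.card_unit, pow_add, pow_one]
  refine le_trans ?_ (mul_le_mul_left ih _)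
  rw [← lintegral_mul_const' _ _ ENNReal.ofReal_ne_top]
  refine lintegral_mono fun b' => ?_
  rw [((volume_preserving_funUnique Unit ℝ).symm).lintegral_map_equiv]
  set A := diagonal b' - W' with hA
  have hblk : ∀ d : ℝ, diagonal ((MeasurableEquiv.sumPiEquivProdPi (fun _ : V ⊕ Unit => ℝ)).symm 
      (b', (MeasurableEquiv.funUnique Unit ℝ).symm d)) - W = blk A w (d - w0) := by
    intro d
    ext i j
    rcases i with i | i <;> rcases j with j | j
    · simp [blk, hA, hW', diagonal_apply, MeasurableEquiv.coe_sumPiEquivProdPi_symm, Equiv.sumPiEquivProdPi_symm_apply]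
    · simp [blk, hw, diagonal_apply]
    · simp [blk, hw, diagonal_apply]
      exact hW.apply _ _
    · simp [blk, hw0, diagonal_apply, MeasurableEquiv.coe_sumPiEquivProdPi_symm, Equiv.sumPiEquivProdPi_symm_apply, MeasurableEquiv.funUnique]
  have hηe : η = Sum.elim η' (fun _ => η0) := by
    ext i; rcases i with i | i <;> simp [hη', hη0]
  simp only [Gd, hblk]
  by_cases hAp : A.PosDef
  swap
  · have : ∀ d, ¬ (blk A w (d - w0)).PosDef := fun d hd => hAp (blk_props _ _ _ hd).1
    simp [this]
  rw [if_pos hAp]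
  set κ := w ⬝ᵥ (A⁻¹ *ᵥ w) with hκ
  set q := η0 + w ⬝ᵥ (A⁻¹ *ᵥ η') with hq
  have hqpos : 0 < q := by
    refine add_pos_of_pos_of_nonneg (hη _) (Finset.sum_nonneg fun i _ => mul_nonneg (h0 _ _) ?_)
    refine mmat_inv_nonneg A hAp (fun i j hij => ?_) _ (fun i => (hη _).le) i
    simp [hA, diagonal_apply, hij]
    exact h0 _ _
  set K := ENNReal.ofReal ((√(A.det))⁻¹ *
      Real.exp (-(1/2) * ∑ i, ∑ j, A i j
        - (1/2) * ((η' + w) ⬝ᵥ (A⁻¹ *ᵥ (η' + w))) + ∑ i, (η' + w) i)) with hK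
  set F : ℝ → ENNReal := (Set.Ioi (0:ℝ)).indicator 
    fun c => ENNReal.ofReal ((√c)⁻¹ * Real.exp (-(1/2)*(c+q^2/c) + q)) with hF
  have hsym : η' ⬝ᵥ (A⁻¹ *ᵥ w) = w ⬝ᵥ (A⁻¹ *ᵥ η') := by
    have hT : (A⁻¹)ᵀ = A⁻¹ := by
      have := hAp.inv.isHermitian
      simpa [IsHermitian, conjTranspose_eq_transpose_of_trivial] using this
    rw [dotProduct_mulVec, ← mulVec_transpose, hT, dotProduct_comm]
  calc _ ≤ ∫⁻ d : ℝ, K * F (d - (w0 + κ)) := by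
        refine lintegral_mono fun d => ?_
        simp only
        split_ifs with hd
        swap
        · exact zero_le
        obtain ⟨-, hc, hdet, hquad⟩ := blk_props _ _ _ hd
        have hcc : d - (w0 + κ) = d - w0 - w ⬝ᵥ (A⁻¹ *ᵥ w) := by rw [hκ]; ring
        rw [hcc]
        have hq2 := hquad η' η0
        rw [← hηe] at hq2
        rw [hq2, hdet]
        set c := d - w0 - w ⬝ᵥ (A⁻¹ *ᵥ w) with hcdef
        rw [hF, Set.indicator_of_mem (show c ∈ Set.Ioi 0 from hc), hK, ← ENNReal.ofReal_mul (by positivity)]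
        refine le_of_eq ?_
        congr 1
        rw [Real.sqrt_mul hAp.det_pos.le, mul_inv, mul_mul_mul_comm, ← Real.exp_add]
        congr 2
        have hsum : ∑ i, ∑ j, blk A w (d - w0) i j = ∑ i, ∑ j, A i j - 2 * ∑ i, w i + (d - w0) := by
          simp [Fintype.sum_sum_type, blk, Finset.sum_add_distrib]
          ring
        have hηs : ∑ i, η i = ∑ i, η' i + η0 := by
          simp [Fintype.sum_sum_type, hη', hη0]
        rw [hsum, hηs, ← hq]
        have hexp : (η' + w) ⬝ᵥ (A⁻¹ *ᵥ (η' + w)) = η' ⬝ᵥ (A⁻¹ *ᵥ η') + 2 * (w ⬝ᵥ (A⁻¹ *ᵥ η')) + κ := by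
          rw [mulVec_add, dotProduct_add, add_dotProduct, add_dotProduct, hsym, hκ]; ring
        rw [hexp]
        have e1 : w ⬝ᵥ (A⁻¹ *ᵥ η') = q - η0 := by rw [hq]; ring
        have e2 : d - w0 = c + κ := by rw [hcdef, hκ]; ring
        rw [e1, e2]
        simp only [Pi.add_apply, Finset.sum_add_distrib]
        ring
    _ = K * ∫⁻ c, F c := by
        rw [lintegral_const_mul' _ _ ENNReal.ofReal_ne_top, lintegral_sub_right_eq_self F]
    _ ≤ _ := by
        gcongr
        rw [hF, lintegral_indicator measurableSet_Ioi]
        exact gig q hqpos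

lemma GdBound_fin (n : ℕ) : GdBound (Fin n) := by
  induction n with
  | zero =>
    intro W η _ _ _
    have hpd : ∀ b, (Matrix.diagonal b - W).PosDef := fun b => by
      refine Matrix.PosDef.of_dotProduct_mulVec_pos ?_ ?_
      · ext i; exact i.elim0
      · intro x hx; exact absurd (Subsingleton.elim _ _) hx
    simp [Gd, hpd, volume_pi]
  | succ n ih =>
    exact GdBound_equiv (Fintype.equivOfCardEq (by simp)) (GdBound_succ ih)

lemma GdBound_all (V : Type) [Fintype V] [DecidableEq V] : GdBound V :=
  GdBound_equiv (Fintype.equivFin V).symm (GdBound_fin _)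


open Matrix in
/-- The operator `D` with general edge weights. -/
def Dg {V : Type} [Fintype V] [DecidableEq V] (W : Matrix V V ℝ) (ε : ℝ) (t : V → ℝ) : Matrix V V ℝ :=
  diagonal (fun i => ∑ k, W i k * Real.exp (t i + t k) + ε * Real.exp (t i)) -
    of fun i j => W i j * Real.exp (t i + t j)

section DgSec
variable {V : Type} [Fintype V] [DecidableEq V] (W : Matrix V V ℝ) (ε : ℝ) (t : V → ℝ)

open Matrix in
lemma Dg_mulVec (v : V → ℝ) (i : V) : (Dg W ε t *ᵥ v) i =
    (∑ k, W i k * Real.exp (t i + t k) + ε * Real.exp (t i)) * v i - 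
      ∑ j, W i j * Real.exp (t i + t j) * v j := by
  rw [Dg, sub_mulVec, Pi.sub_apply, mulVec_diagonal]
  rfl

lemma sum_symmetrize (f : V → V → ℝ) :
    ∑ i, ∑ j, f i j = (1/2) * ∑ i, ∑ j, (f i j + f j i) := by
  simp only [Finset.sum_add_distrib]
  rw [Finset.sum_comm (f := fun i j => f j i)]
  ring

open Matrix in
lemma Dg_quad (hW : W.IsSymm) (v : V → ℝ) : v ⬝ᵥ (Dg W ε t *ᵥ v) =
    (1/2) * ∑ i, ∑ j, W i j * (Real.exp (t i + t j) * (v i - v j)^2) + ε * ∑ k, Real.exp (t k) * v k ^2 := by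
  have h1 : v ⬝ᵥ (Dg W ε t *ᵥ v) = ∑ i, ∑ j, W i j * Real.exp (t i + t j) * (v i * v i - v i * v j) 
      + ε * ∑ k, Real.exp (t k) * v k ^2 := by
    simp only [dotProduct, Dg_mulVec, Finset.mul_sum]
    rw [← Finset.sum_add_distrib]
    refine Finset.sum_congr rfl fun i _ => ?_
    rw [mul_sub, ← mul_assoc, mul_add, add_mul, Finset.mul_sum, Finset.mul_sum, Finset.sum_mul, add_sub_right_comm, ← Finset.sum_sub_distrib]
    congr 1
    · refine Finset.sum_congr rfl fun j _ => ?_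
      ring
    · ring
  rw [h1, sum_symmetrize]
  congr 2
  refine Finset.sum_congr rfl fun i _ => Finset.sum_congr rfl fun j _ => ?_
  rw [hW.apply i j, add_comm (t j) (t i)]
  ring

open Matrix in
lemma Dg_posDef (hW : W.IsSymm) (h0 : ∀ i j, 0 ≤ W i j) (hε : 0 < ε) : (Dg W ε t).PosDef := by
  refine Matrix.PosDef.of_dotProduct_mulVec_pos ?_ ?_
  · rw [Matrix.IsHermitian, conjTranspose_eq_transpose_of_trivial, Dg, transpose_sub, diagonal_transpose]
    congr 1
    ext i j
    simp only [transpose_apply, of_apply]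
    rw [hW.apply i j, add_comm]
  · intro x hx
    rw [star_trivial, Dg_quad W ε t hW]
    obtain ⟨k, hk⟩ := Function.ne_iff.1 hx
    have h1 : 0 ≤ ∑ i, ∑ j, W i j * (Real.exp (t i + t j) * (x i - x j)^2) :=
      Finset.sum_nonneg fun i _ => Finset.sum_nonneg fun j _ => mul_nonneg (h0 _ _) (by positivity)
    have h2 : 0 < ∑ k, Real.exp (t k) * x k ^2 :=
      Finset.sum_pos' (fun i _ => by positivity) ⟨k, Finset.mem_univ _, by
        have : x k ≠ 0 := hk
        positivity⟩
    have := mul_pos hε h2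
    linarith

open scoped MatrixOrder in
open Matrix in
lemma gauss_matrix (D : Matrix V V ℝ) (hD : D.PosDef) :
    ∫⁻ s : V → ℝ, ENNReal.ofReal (Real.exp (-(1/2) * (s ⬝ᵥ (D *ᵥ s)))) = 
      ENNReal.ofReal ((√D.det)⁻¹) * (ENNReal.ofReal √(2*Real.pi)) ^ (Fintype.card V) := by
  obtain ⟨M, hM⟩ : ∃ M : Matrix V V ℝ, D = Mᵀ * M := by
    obtain ⟨M, hM⟩ := CStarAlgebra.nonneg_iff_eq_star_mul_self.1 (Matrix.nonneg_iff_posSemidef.2 hD.posSemidef)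
    exact ⟨M, by rw [hM, star_eq_conjTranspose, conjTranspose_eq_transpose_of_trivial]⟩
  have hdet : D.det = M.det^2 := by rw [hM, det_mul, det_transpose, sq]
  have hM0 : M.det ≠ 0 := by
    intro h
    have := hD.det_pos
    rw [hdet, h] at this
    simp at this
  have hq : ∀ s, s ⬝ᵥ (D *ᵥ s) = ∑ i, (toLin' M s i)^2 := by
    intro s
    rw [hM, ← mulVec_mulVec, dotProduct_mulVec, vecMul_transpose]
    simp [dotProduct, sq]
  have hcont : Measurable (fun x : V → ℝ => ENNReal.ofReal (Real.exp (-(1/2) * ∑ i, (x i)^2))) := by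
    fun_prop
  simp only [hq]
  rw [← lintegral_map (f := fun x : V → ℝ => ENNReal.ofReal (Real.exp (-(1/2) * ∑ i, (x i)^2))) (g := toLin' M) hcont
    (LinearMap.continuous_of_finiteDimensional _).measurable, Real.map_matrix_volume_pi_eq_smul_volume_pi hM0,
    lintegral_smul_measure, smul_eq_mul]
  congr 1
  · rw [hdet, Real.sqrt_sq_eq_abs, abs_inv]
  · have he : ∀ x : V → ℝ, Real.exp (-(1/2) * ∑ i, (x i)^2) = ∏ i, Real.exp (-(1/2) * (x i)^2) := by
      intro x; rw [← Real.exp_sum, Finset.mul_sum]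
    simp only [he]
    have hInt : Integrable (fun x : V → ℝ => ∏ i, Real.exp (-(1/2) * (x i)^2)) volume :=
      Integrable.fintype_prod (f := fun _ x => Real.exp (-(1/2) * x^2)) fun i => integrable_exp_neg_mul_sq (by norm_num)
    rw [← ofReal_integral_eq_lintegral_ofReal hInt
      (Filter.Eventually.of_forall fun x => Finset.prod_nonneg fun i _ => (Real.exp_pos _).le),
      integral_fintype_prod_volume_eq_pow (fun x : ℝ => Real.exp (-(1/2) * x^2)), integral_gaussian,
      ENNReal.ofReal_pow (by positivity)]
    congr 3; ring

/-- The change of variables from `t` to the potential. -/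
def pot (i : V) : ℝ := ∑ j, W i j * Real.exp (t j - t i) + ε * Real.exp (-t i)

open Matrix in
lemma pot_matrix : diagonal (pot W ε t) - W = 
    diagonal (fun i => Real.exp (-t i)) * Dg W ε t * diagonal (fun i => Real.exp (-t i)) := by
  have e1 : ∀ i k, Real.exp (t k - t i) = Real.exp (-t i) * Real.exp (t i + t k) * Real.exp (-t i) := by
    intro i k; rw [← Real.exp_add, ← Real.exp_add]; congr 1; ring
  have e2 : ∀ i, Real.exp (-t i) = Real.exp (-t i) * Real.exp (t i) * Real.exp (-t i) := by
    intro i; rw [← Real.exp_add, ← Real.exp_add]; congr 1; ring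
  have e3 : ∀ i j, Real.exp (-t i) * Real.exp (t i + t j) * Real.exp (-t j) = 1 := by
    intro i j; rw [← Real.exp_add, ← Real.exp_add, ← Real.exp_zero]; congr 1; ring
  ext i j
  rw [mul_diagonal, diagonal_mul, Dg, Matrix.sub_apply, Matrix.sub_apply, of_apply, mul_sub, sub_mul]
  congr 1
  · by_cases h : i = j
    · subst h
      simp only [diagonal_apply_eq, pot]
      rw [mul_add, add_mul, Finset.mul_sum, Finset.sum_mul]
      congr 1
      · refine Finset.sum_congr rfl fun k _ => ?_
        rw [e1]; ring
      · conv_lhs => rw [e2]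
        ring
    · simp [diagonal_apply_ne _ h]
  · linear_combination (-W i j) * e3 i j

open Matrix in
lemma pot_posDef (hW : W.IsSymm) (h0 : ∀ i j, 0 ≤ W i j) (hε : 0 < ε) : 
    (diagonal (pot W ε t) - W).PosDef := by
  rw [pot_matrix]
  have hu : IsUnit (diagonal (fun i => Real.exp (-t i))) := by
    rw [isUnit_iff_isUnit_det, det_diagonal]
    exact (Finset.prod_pos fun i _ => Real.exp_pos _).ne'.isUnit
  have := (Matrix.IsUnit.posDef_star_left_conjugate_iff hu (x := Dg W ε t)).2 (Dg_posDef W ε t hW h0 hε)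
  simpa [star_eq_conjTranspose, diagonal_conjTranspose] using this

open Matrix in
lemma pot_inv (hW : W.IsSymm) (h0 : ∀ i j, 0 ≤ W i j) (hε : 0 < ε) : 
    (diagonal (pot W ε t) - W)⁻¹ *ᵥ (fun _ => ε) = fun i => Real.exp (t i) := by
  refine inv_mulVec_eq _ (pot_posDef W ε t hW h0 hε) _ _ ?_
  ext i
  rw [sub_mulVec, Pi.sub_apply, mulVec_diagonal]
  simp only [pot, mulVec, dotProduct]
  rw [add_mul, Finset.sum_mul, add_sub_right_comm, ← Finset.sum_sub_distrib]
  rw [Finset.sum_eq_zero, zero_add, mul_assoc, ← Real.exp_add]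
  · simp
  · intro j _
    rw [mul_assoc, ← Real.exp_add, sub_add_cancel, sub_self]

lemma pot_inj (hW : W.IsSymm) (h0 : ∀ i j, 0 ≤ W i j) (hε : 0 < ε) : 
    Function.Injective (pot W ε) := by
  intro t t' h
  have h1 := pot_inv W ε t hW h0 hε
  rw [h, pot_inv W ε t' hW h0 hε] at h1
  ext i
  exact (Real.exp_injective (congrFun h1 i)).symm

open Matrix in
lemma pot_deriv : HasFDerivAt (pot W ε) 
    (LinearMap.toContinuousLinearMap (toLin' (-(diagonal (fun i => Real.exp (-(2 * t i))) * Dg W ε t)))) t := by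
  rw [hasFDerivAt_pi']
  intro i
  have hp : ∀ j, HasFDerivAt (fun t : V → ℝ => t j) (ContinuousLinearMap.proj (R := ℝ) (φ := fun _ : V => ℝ) j) t := 
    fun j => hasFDerivAt_apply j t
  have h1 := (HasFDerivAt.fun_sum (u := Finset.univ) fun j _ => (((hp j).sub (hp i)).exp.const_mul (W i j))).add 
    (((hp i).neg.exp).const_mul ε)
  refine h1.congr_fderiv ?_
  have e1 : ∀ k, Real.exp (t k - t i) = Real.exp (-(2 * t i)) * Real.exp (t i + t k) := by
    intro k; rw [← Real.exp_add]; congr 1; ring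
  have e2 : Real.exp (-t i) = Real.exp (-(2 * t i)) * Real.exp (t i) := by
    rw [← Real.exp_add]; congr 1; ring
  ext v
  simp only [ContinuousLinearMap.add_apply, ContinuousLinearMap.sum_apply, ContinuousLinearMap.smul_apply,
    ContinuousLinearMap.sub_apply, ContinuousLinearMap.neg_apply, ContinuousLinearMap.proj_apply, smul_eq_mul,
    ContinuousLinearMap.comp_apply, LinearMap.coe_toContinuousLinearMap', toLin'_apply, neg_mulVec, Pi.neg_apply,
    ← mulVec_mulVec, mulVec_diagonal, Dg_mulVec, e1, Pi.sub_apply]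
  rw [e2, mul_sub, add_mul, mul_add, Finset.sum_mul, Finset.mul_sum, Finset.mul_sum, neg_sub, ← sub_sub, ← Finset.sum_sub_distrib, sub_eq_add_neg]
  congr 1
  · refine Finset.sum_congr rfl fun j _ => ?_
    ring
  · ring

open Matrix in
lemma t_bound (hW : W.IsSymm) (h0 : ∀ i j, 0 ≤ W i j) (hε : 0 < ε) : 
    ∫⁻ t : V → ℝ, ENNReal.ofReal (√(Dg W ε t).det * Real.exp (-(1/2) * ∑ i, ∑ j, W i j * (Real.cosh (t i - t j) - 1)
      - ε * ∑ k, (Real.cosh (t k) - 1)) * ∏ k, Real.exp (-t k)) ≤ (ENNReal.ofReal √(2*Real.pi)) ^ (Fintype.card V) := by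
  have key := lintegral_image_eq_lintegral_abs_det_fderiv_mul volume (s := Set.univ) MeasurableSet.univ 
    (fun t _ => (pot_deriv W ε t).hasFDerivWithinAt) (pot_inj W ε hW h0 hε).injOn (Gd W (fun _ => ε))
  rw [setLIntegral_univ] at key
  refine le_trans (le_of_eq ?_) ((setLIntegral_le_lintegral (pot W ε '' Set.univ) _).trans (GdBound_all V W (fun _ => ε) hW h0 (fun _ => hε)))
  rw [key]
  refine lintegral_congr fun t => ?_
  have hDp := (Dg_posDef W ε t hW h0 hε).det_pos
  have hP : 0 < ∏ k, Real.exp (-t k) := Finset.prod_pos fun i _ => Real.exp_pos _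
  rw [Gd, if_pos (pot_posDef W ε t hW h0 hε), ← ENNReal.ofReal_mul (abs_nonneg _), pot_inv W ε t hW h0 hε]
  congr 1
  have hd1 : |(LinearMap.toContinuousLinearMap (toLin' (-(diagonal (fun i => Real.exp (-(2 * t i))) * Dg W ε t)))).det|
      = (∏ k, Real.exp (-t k))^2 * (Dg W ε t).det := by
    rw [LinearMap.det_toContinuousLinearMap, LinearMap.det_toLin', det_neg, abs_mul, abs_pow, abs_neg, abs_one, one_pow, one_mul,
      det_mul, det_diagonal]
    have : ∏ i, Real.exp (-(2 * t i)) = (∏ k, Real.exp (-t k))^2 := by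
      rw [← Finset.prod_pow]
      refine Finset.prod_congr rfl fun i _ => ?_
      rw [← Real.exp_nat_mul]; congr 1; push_cast; ring
    rw [this, abs_of_pos (by positivity)]
  have hd2 : √(diagonal (pot W ε t) - W).det = (∏ k, Real.exp (-t k)) * √(Dg W ε t).det := by
    rw [pot_matrix, det_mul, det_mul, det_diagonal, mul_right_comm, Real.sqrt_mul (by positivity), Real.sqrt_mul_self hP.le]
  have hex : -(1/2) * ∑ i, ∑ j, (diagonal (pot W ε t) - W) i j
        - (1/2) * ((fun _ => ε) ⬝ᵥ (fun i => Real.exp (t i))) + ∑ i : V, ε = 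
     -(1/2) * ∑ i, ∑ j, W i j * (Real.cosh (t i - t j) - 1) - ε * ∑ k, (Real.cosh (t k) - 1) := by
    have a1 : ∑ i, ∑ j, (diagonal (pot W ε t) - W) i j = ∑ i, ∑ j, W i j * (Real.exp (t j - t i) - 1) + ε * ∑ i, Real.exp (-t i) := by
      rw [Finset.mul_sum, ← Finset.sum_add_distrib]
      refine Finset.sum_congr rfl fun i _ => ?_
      simp only [Matrix.sub_apply, Finset.sum_sub_distrib, mul_sub, diagonal_apply, Finset.sum_ite_eq, Finset.mem_univ, if_true, pot]
      simp only [mul_one]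
      ring
    have a2 : ∑ i, ∑ j, W i j * (Real.exp (t j - t i) - 1) = ∑ i, ∑ j, W i j * (Real.cosh (t i - t j) - 1) := by
      rw [sum_symmetrize, Finset.mul_sum]
      refine Finset.sum_congr rfl fun i _ => ?_
      rw [Finset.mul_sum]
      refine Finset.sum_congr rfl fun j _ => ?_
      rw [hW.apply i j, Real.cosh_eq, neg_sub]
      ring
    have a3 : ∑ k, (Real.cosh (t k) - 1) = (1/2) * ∑ i, Real.exp (t i) + (1/2) * ∑ i, Real.exp (-t i) - ∑ i : V, 1 := by
      rw [Finset.mul_sum, Finset.mul_sum, ← Finset.sum_add_distrib, ← Finset.sum_sub_distrib]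
      refine Finset.sum_congr rfl fun i _ => ?_
      rw [Real.cosh_eq]; ring
    rw [a1, a2, a3]
    simp only [dotProduct, ← Finset.mul_sum]
    rw [show ∑ i : V, ε = ε * ∑ i : V, 1 by rw [Finset.mul_sum]; simp]
    ring
  rw [hd1, hd2, hex]
  have hs : 0 < √(Dg W ε t).det := Real.sqrt_pos.2 hDp
  obtain ⟨r, hr, hrr⟩ : ∃ r, 0 < r ∧ (Dg W ε t).det = r^2 := ⟨_, hs, (Real.sq_sqrt hDp.le).symm⟩
  rw [hrr, Real.sqrt_sq hr.le]
  field_simp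

end DgSec


section Fin
variable {V : Type} [Fintype V] [DecidableEq V]

open Matrix in
lemma norm_bound (W : Matrix V V ℝ) (ε : ℝ) (hW : W.IsSymm) (h0 : ∀ i j, 0 ≤ W i j) (hε : 0 < ε) :
    ∫⁻ p : (V → ℝ) × (V → ℝ), ENNReal.ofReal ((Dg W ε p.1).det *
      Real.exp (-((1/2) * ∑ i, ∑ j, W i j * 
          (Real.cosh (p.1 i - p.1 j) + (1/2) * (p.2 i - p.2 j)^2 * Real.exp (p.1 i + p.1 j) - 1))
        - ε * ∑ k, (Real.cosh (p.1 k) + (1/2) * (p.2 k)^2 * Real.exp (p.1 k) - 1)) *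
      (∏ k, Real.exp (-(p.1 k))) * ((2 * Real.pi)⁻¹) ^ (Fintype.card V)) ≤ 1 := by
  refine (lintegral_prod_le _).trans ?_
  set g := ENNReal.ofReal √(2*Real.pi) ^ (Fintype.card V) with hg
  have hg0 : g ≠ 0 := by
    refine pow_ne_zero _ ?_
    simp only [ne_eq, ENNReal.ofReal_eq_zero, not_le]
    positivity
  have hgt : g ≠ ⊤ := ENNReal.pow_ne_top ENNReal.ofReal_ne_top
  have hgg : ENNReal.ofReal (((2 * Real.pi)⁻¹) ^ (Fintype.card V)) = g⁻¹ * g⁻¹ := by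
    rw [← ENNReal.mul_inv (Or.inl hg0) (Or.inl hgt), hg, ← mul_pow, ← ENNReal.ofReal_mul (by positivity), Real.mul_self_sqrt (by positivity),
      ENNReal.ofReal_pow (by positivity), ENNReal.ofReal_inv_of_pos (by positivity), ENNReal.inv_pow]
  calc _ = ∫⁻ t : V → ℝ, ENNReal.ofReal (√(Dg W ε t).det * Real.exp (-(1/2) * ∑ i, ∑ j, W i j * (Real.cosh (t i - t j) - 1)
      - ε * ∑ k, (Real.cosh (t k) - 1)) * ∏ k, Real.exp (-t k)) * g⁻¹ := by
        refine lintegral_congr fun t => ?_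
        have hDp := (Dg_posDef W ε t hW h0 hε).det_pos
        have hP : 0 < ∏ k, Real.exp (-t k) := Finset.prod_pos fun i _ => Real.exp_pos _
        set E := Real.exp (-(1/2) * ∑ i, ∑ j, W i j * (Real.cosh (t i - t j) - 1)
          - ε * ∑ k, (Real.cosh (t k) - 1)) with hE
        have hE0 : 0 < E := Real.exp_pos _
        have hs : ∀ s : V → ℝ, ENNReal.ofReal ((Dg W ε t).det *
          Real.exp (-((1/2) * ∑ i, ∑ j, W i j * 
              (Real.cosh (t i - t j) + (1/2) * (s i - s j)^2 * Real.exp (t i + t j) - 1))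
            - ε * ∑ k, (Real.cosh (t k) + (1/2) * (s k)^2 * Real.exp (t k) - 1)) *
          (∏ k, Real.exp (-(t k))) * ((2 * Real.pi)⁻¹) ^ (Fintype.card V)) = 
          (ENNReal.ofReal ((Dg W ε t).det * E * ∏ k, Real.exp (-(t k))) * (g⁻¹ * g⁻¹)) * 
            ENNReal.ofReal (Real.exp (-(1/2) * (s ⬝ᵥ (Dg W ε t *ᵥ s)))) := by
          intro s
          rw [← hgg, ← ENNReal.ofReal_mul (by positivity), ← ENNReal.ofReal_mul (by positivity)]
          congr 1
          have : Real.exp (-((1/2) * ∑ i, ∑ j, W i j * 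
              (Real.cosh (t i - t j) + (1/2) * (s i - s j)^2 * Real.exp (t i + t j) - 1))
            - ε * ∑ k, (Real.cosh (t k) + (1/2) * (s k)^2 * Real.exp (t k) - 1)) =
              E * Real.exp (-(1/2) * (s ⬝ᵥ (Dg W ε t *ᵥ s))) := by
            rw [hE, ← Real.exp_add, Dg_quad W ε t hW]
            congr 1
            have a1 : ∑ i, ∑ j, W i j * 
              (Real.cosh (t i - t j) + (1/2) * (s i - s j)^2 * Real.exp (t i + t j) - 1) = 
              ∑ i, ∑ j, W i j * (Real.cosh (t i - t j) - 1) + 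
                (1/2) * ∑ i, ∑ j, W i j * (Real.exp (t i + t j) * (s i - s j)^2) := by
              simp only [Finset.mul_sum, ← Finset.sum_add_distrib]
              refine Finset.sum_congr rfl fun i _ => Finset.sum_congr rfl fun j _ => ?_
              ring
            have a2 : ∑ k, (Real.cosh (t k) + (1/2) * (s k)^2 * Real.exp (t k) - 1) =
              ∑ k, (Real.cosh (t k) - 1) + (1/2) * ∑ k, Real.exp (t k) * s k ^2 := by
              simp only [Finset.mul_sum, ← Finset.sum_add_distrib]
              refine Finset.sum_congr rfl fun i _ => ?_
              ring
            rw [a1, a2]; ring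
          rw [this]; ring
        simp only [hs]
        rw [lintegral_const_mul' _ _ (ENNReal.mul_ne_top ENNReal.ofReal_ne_top (ENNReal.mul_ne_top (ENNReal.inv_ne_top.2 hg0) (ENNReal.inv_ne_top.2 hg0))),
          gauss_matrix _ (Dg_posDef W ε t hW h0 hε), ← hg]
        have : ENNReal.ofReal (√(Dg W ε t).det * E * ∏ k, Real.exp (-t k)) = 
          ENNReal.ofReal ((Dg W ε t).det * E * ∏ k, Real.exp (-t k)) * ENNReal.ofReal ((√(Dg W ε t).det)⁻¹) := by
          rw [← ENNReal.ofReal_mul (by positivity)]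
          congr 1
          have hs : 0 < √(Dg W ε t).det := Real.sqrt_pos.2 hDp
          obtain ⟨r, hr, hrr⟩ : ∃ r, 0 < r ∧ (Dg W ε t).det = r^2 := ⟨_, hs, (Real.sq_sqrt hDp.le).symm⟩
          rw [hrr, Real.sqrt_sq hr.le]
          field_simp
        rw [this]
        have h1 : g⁻¹ * g = 1 := ENNReal.inv_mul_cancel hg0 hgt
        calc _ = ENNReal.ofReal ((Dg W ε t).det * E * ∏ k, Real.exp (-t k)) * ENNReal.ofReal ((√(Dg W ε t).det)⁻¹) * g⁻¹ * (g⁻¹ * g) := by ring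
          _ = _ := by rw [h1, mul_one]
    _ ≤ g * g⁻¹ := by
        rw [lintegral_mul_const' _ _ (ENNReal.inv_ne_top.2 hg0)]
        gcongr
        exact t_bound W ε hW h0 hε
    _ = 1 := ENNReal.mul_inv_cancel hg0 hgt

/-- edge matrix -/
def Em (x y : V) : Matrix V V ℝ := Matrix.of fun a b => if s(a,b) = s(x,y) then 1 else 0

lemma Em_apply (x y : V) (hxy : x ≠ y) (a b : V) : Em x y a b = 
    (if a = x then (if b = y then 1 else 0) else 0) + (if a = y then (if b = x then 1 else 0) else 0) := by
  simp only [Em, Matrix.of_apply, Sym2.eq_iff]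
  by_cases h1 : a = x
  · subst h1; simp [hxy]
  · simp [h1, ← ite_and]

lemma Em_symm (x y : V) : (Em x y).IsSymm := by
  ext a b
  simp only [Em, Matrix.transpose_apply, Matrix.of_apply]
  rw [show s(b,a) = s(a,b) from Sym2.eq_swap]

lemma Em_nonneg (x y a b : V) : 0 ≤ Em x y a b := by
  simp only [Em, Matrix.of_apply]; split_ifs <;> simp

open Matrix in
lemma Dg_edge (R : Matrix V V ℝ) (ε p : ℝ) (t : V → ℝ) (x y : V) (hxy : x ≠ y) :
    Dg (R + p • Em x y) ε t = Dg R ε t + 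
      replicateCol Unit ((p * Real.exp (t x + t y)) • (Pi.single x 1 - Pi.single y 1 : V → ℝ)) *
      replicateRow Unit (Pi.single x 1 - Pi.single y 1 : V → ℝ) := by
  ext i j
  have hs : ∑ k, (R + p • Em x y) i k * Real.exp (t i + t k) = ∑ k, R i k * Real.exp (t i + t k) + 
     p * ((if i = x then Real.exp (t x + t y) else 0) + (if i = y then Real.exp (t x + t y) else 0)) := by
    simp only [Matrix.add_apply, Matrix.smul_apply, Em_apply x y hxy, add_mul, Finset.sum_add_distrib, smul_eq_mul, mul_assoc, ← Finset.mul_sum]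
    congr 2
    congr 1
    · by_cases h : i = x <;> simp [h]
    · by_cases h : i = y <;> simp [h, add_comm]
  have e1 : Dg (R + p • Em x y) ε t i j = (if i = j then ∑ k, (R + p • Em x y) i k * Real.exp (t i + t k) + ε * Real.exp (t i) else 0)
      - (R + p • Em x y) i j * Real.exp (t i + t j) := by
    simp only [Dg, Matrix.sub_apply, diagonal_apply, of_apply]
  rw [e1, hs]
  simp only [Dg, Matrix.sub_apply, Matrix.add_apply, of_apply, mul_apply, replicateCol_apply, replicateRow_apply, Pi.smul_apply, Pi.sub_apply,
    Pi.single_apply, Finset.univ_unique, Finset.sum_const, Finset.card_singleton, one_smul, smul_eq_mul, Matrix.smul_apply, Em_apply x y hxy, diagonal_apply]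
  have hyx := hxy.symm
  have hc := add_comm (t x) (t y)
  by_cases hi : i = x
  · subst hi
    by_cases hj : j = i
    · subst hj; simp [hxy]; ring
    · by_cases hj2 : j = y
      · subst hj2; simp [hxy, hyx]; ring
      · simp [hxy, hj, hj2, Ne.symm hj]
  · by_cases hi2 : i = y
    · subst hi2
      by_cases hj : j = i
      · subst hj; simp [hxy, hyx]; ring
      · by_cases hj2 : j = x
        · subst hj2; simp [hxy, hyx, hc]; ring
        · simp [hyx, hj, hj2, Ne.symm hj]
    · simp [hi, hi2]

open Matrix in
lemma det_edge (R : Matrix V V ℝ) (hR : R.IsSymm) (h0 : ∀ i j, 0 ≤ R i j) (ε p γ : ℝ) (hε : 0 < ε)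
    (hγ0 : 0 < γ) (hγ1 : γ < 1) (t : V → ℝ) (x y : V) (hxy : x ≠ y) :
    (1 - γ) * (Dg (R + p • Em x y) ε t).det ≤ (Dg (R + (p * (1 - γ)) • Em x y) ε t).det := by
  have hQ := Dg_posDef R ε t hR h0 hε
  set Q := Dg R ε t with hQd
  set u : V → ℝ := (Pi.single x 1 - Pi.single y 1 : V → ℝ) with hu
  have key : ∀ p, (Dg (R + p • Em x y) ε t).det = Q.det * (1 + (p * Real.exp (t x + t y)) * (u ⬝ᵥ (Q⁻¹ *ᵥ u))) := by
    intro p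
    rw [Dg_edge R ε p t x y hxy, det_add_replicateCol_mul_replicateRow hQ.det_pos.ne'.isUnit]
    congr 1
    rw [det_unique, Matrix.add_apply, one_apply_eq]
    congr 1
    have e1 : u ⬝ᵥ (Q⁻¹ *ᵥ ((p * Real.exp (t x + t y)) • u)) = (p * Real.exp (t x + t y)) * (u ⬝ᵥ (Q⁻¹ *ᵥ u)) := by
      rw [mulVec_smul, dotProduct_smul, smul_eq_mul]
    rw [← e1, Matrix.mul_assoc]
    rfl
  have hr : 0 ≤ u ⬝ᵥ (Q⁻¹ *ᵥ u) := by
    have := hQ.inv.posSemidef.dotProduct_mulVec_nonneg u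
    simpa using this
  rw [key, key]
  have := hQ.det_pos
  nlinarith [mul_pos hγ0 this]

lemma integral_le_of_lintegral {α : Type*} [MeasurableSpace α] (μ : Measure α) (f : α → ℝ) (C : ℝ) (hC : 0 ≤ C)
    (hf : ∀ x, 0 ≤ f x) (h : ∫⁻ x, ENNReal.ofReal (f x) ∂μ ≤ ENNReal.ofReal C) : ∫ x, f x ∂μ ≤ C := by
  by_cases hi : Integrable f μ
  · rw [integral_eq_lintegral_of_nonneg_ae (Filter.Eventually.of_forall hf) hi.1]
    exact ENNReal.toReal_le_of_le_ofReal hC h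
  · rw [integral_undef hi]; exact hC

/-- Weights with a set of edges damped. -/
def Wt (N : V → V → Prop) (β γ : ℝ) {n : ℕ} (x y : Fin n → V) (T : Finset (Fin n)) : Matrix V V ℝ :=
  Matrix.of fun a b => β * ((if N a b then 1 else 0) - γ * ∑ j ∈ T, Em (x j) (y j) a b)

variable (N : V → V → Prop) (hN : ∀ a b, N a b → N b a) (β γ : ℝ) (hβ : 0 < β)
  (hγ0 : 0 < γ) (hγ1 : γ < 1) {n : ℕ} (x y : Fin n → V) (hxy : ∀ j, N (x j) (y j))
  (hinj : Function.Injective fun j => s(x j, y j))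

include hN in
lemma Wt_symm (T : Finset (Fin n)) : (Wt N β γ x y T).IsSymm := by
  ext a b
  have : N a b ↔ N b a := ⟨hN _ _, hN _ _⟩
  simp only [Wt, Matrix.transpose_apply, Matrix.of_apply, this]
  congr 3
  exact Finset.sum_congr rfl fun j _ => (Em_symm (x j) (y j)).apply a b

include hN hxy hinj in
lemma Em_sum_le (T : Finset (Fin n)) (a b : V) :
    ∑ j ∈ T, Em (x j) (y j) a b ≤ if N a b then 1 else 0 := by
  by_cases h : ∃ j ∈ T, s(a,b) = s(x j, y j)
  · obtain ⟨j, hj, he⟩ := h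
    have hNab : N a b := by
      rcases Sym2.eq_iff.1 he with ⟨h1, h2⟩ | ⟨h1, h2⟩
      · rw [h1, h2]; exact hxy j
      · rw [h1, h2]; exact hN _ _ (hxy j)
    rw [if_pos hNab, Finset.sum_eq_single j]
    · simp only [Em, Matrix.of_apply, he, if_true, le_refl]
    · intro k _ hk
      simp only [Em, Matrix.of_apply]
      rw [if_neg]
      intro h2
      exact hk (hinj (h2.symm.trans he))
    · intro h; exact absurd hj h
  · push Not at h
    rw [Finset.sum_eq_zero]
    · split_ifs <;> simp
    · intro j hj
      simp only [Em, Matrix.of_apply, if_neg (h j hj)]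

include hN hxy hinj hβ hγ0 hγ1 in
lemma Wt_nonneg (T : Finset (Fin n)) (a b : V) : 0 ≤ Wt N β γ x y T a b := by
  have h1 := Em_sum_le N hN x y hxy hinj T a b
  have h2 : 0 ≤ ∑ j ∈ T, Em (x j) (y j) a b := Finset.sum_nonneg fun j _ => Em_nonneg _ _ _ _
  refine mul_nonneg hβ.le ?_
  nlinarith

include hN hxy hinj hβ hγ0 hγ1 in
lemma det_Wt (hne : ∀ j, x j ≠ y j) (ε : ℝ) (hε : 0 < ε) (t : V → ℝ) (T : Finset (Fin n)) :
    (1 - γ) ^ T.card * (Dg (Wt N β γ x y ∅) ε t).det ≤ (Dg (Wt N β γ x y T) ε t).det := by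
  induction T using Finset.induction_on with
  | empty => simp
  | insert j T hj ih =>
    rw [Finset.card_insert_of_notMem hj, pow_succ']
    have h1 := det_edge (Wt N β γ x y T - β • Em (x j) (y j))
      ((Wt_symm N hN β γ x y T).sub ((Em_symm _ _).smul β)) (fun a b => by
        have h1 := Em_sum_le N hN x y hxy hinj (insert j T) a b
        rw [Finset.sum_insert hj] at h1
        have h2 : 0 ≤ ∑ j ∈ T, Em (x j) (y j) a b := Finset.sum_nonneg fun j _ => Em_nonneg _ _ _ _
        simp only [Wt, Matrix.sub_apply, Matrix.of_apply, Matrix.smul_apply, smul_eq_mul, ← mul_sub]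
        refine mul_nonneg hβ.le ?_
        nlinarith) ε β γ hε hγ0 hγ1 t (x j) (y j) (hne j)
    rw [sub_add_cancel] at h1
    have h2 : Wt N β γ x y T - β • Em (x j) (y j) + (β * (1 - γ)) • Em (x j) (y j) = Wt N β γ x y (insert j T) := by
      ext a b
      simp only [Wt, Matrix.sub_apply, Matrix.add_apply, Matrix.of_apply, Matrix.smul_apply, smul_eq_mul, Finset.sum_insert hj]
      ring
    rw [h2] at h1
    refine le_trans ?_ h1
    rw [mul_assoc]
    exact mul_le_mul_of_nonneg_left ih (by linarith)

lemma Em_sum (x y : V) (hxy : x ≠ y) (f : V → V → ℝ) (hf : ∀ a b, f a b = f b a) : 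
    (1/2) * ∑ a, ∑ b, Em x y a b * f a b = f x y := by
  have : ∀ a, ∑ b, Em x y a b * f a b = (if a = x then f x y else 0) + (if a = y then f x y else 0) := by
    intro a
    simp only [Em_apply x y hxy, add_mul, Finset.sum_add_distrib]
    congr 1
    · by_cases h : a = x <;> simp [h]
    · by_cases h : a = y <;> simp [h, hf]
  simp only [this, Finset.sum_add_distrib, Finset.sum_ite_eq', Finset.mem_univ, if_true]
  ring

lemma Wt_sum (hne : ∀ j, x j ≠ y j) (f : V → V → ℝ) (hf : ∀ a b, f a b = f b a) :
    (1/2) * ∑ a, ∑ b, Wt N β γ x y Finset.univ a b * f a b = 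
      β * ((1/2) * ∑ a, ∑ b, if N a b then f a b else 0) - β * γ * ∑ j, f (x j) (y j) := by
  have h1 : ∀ j, f (x j) (y j) = (1/2) * ∑ a, ∑ b, Em (x j) (y j) a b * f a b := 
    fun j => (Em_sum _ _ (hne j) f hf).symm
  have h2 : ∑ j, f (x j) (y j) = (1/2) * ∑ a, ∑ b, (∑ j, Em (x j) (y j) a b) * f a b := by
    rw [Finset.sum_congr rfl fun j _ => h1 j, ← Finset.mul_sum, Finset.sum_comm]
    congr 1
    refine Finset.sum_congr rfl fun a _ => ?_
    rw [Finset.sum_comm]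
    refine Finset.sum_congr rfl fun b _ => ?_
    rw [Finset.sum_mul]
  have h3 : ∑ a, ∑ b, Wt N β γ x y Finset.univ a b * f a b =
      β * (∑ a, ∑ b, if N a b then f a b else 0) - β * γ * ∑ a, ∑ b, (∑ j, Em (x j) (y j) a b) * f a b := by
    rw [Finset.mul_sum, Finset.mul_sum, ← Finset.sum_sub_distrib]
    refine Finset.sum_congr rfl fun a _ => ?_
    rw [Finset.mul_sum, Finset.mul_sum, ← Finset.sum_sub_distrib]
    refine Finset.sum_congr rfl fun b _ => ?_
    simp only [Wt, Matrix.of_apply]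
    split_ifs <;> ring
  rw [h2, h3]; ring

end Fin


lemma NN_symm {L : ℕ} (a b : Torus L) (h : NN a b) : NN b a := by
  obtain ⟨h1, i, h2⟩ := h
  refine ⟨h1.symm, i, ?_⟩
  rcases h2 with h2 | h2
  · right; rw [h2]; abel
  · left; rw [h2]; abel

lemma Dmat_eq {L : ℕ} [NeZero L] (β ε γ : ℝ) (t : Torus L → ℝ) {n : ℕ} (x y : Fin n → Torus L) :
    Dmat β ε t = Dg (Wt NN β γ x y ∅) ε t := by
  ext j k
  simp only [Dmat, Dg, Wt, Matrix.sub_apply, Matrix.of_apply, Matrix.diagonal_apply, Finset.sum_empty, mul_zero, sub_zero]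
  have hirr : ∀ a : Torus L, ¬ NN a a := fun a h => h.1 rfl
  by_cases h : j = k
  · subst h
    rw [if_pos rfl, if_pos rfl, if_neg (hirr j), mul_zero, zero_mul, sub_zero, Finset.mul_sum]
    congr 1
    refine Finset.sum_congr rfl fun i _ => ?_
    by_cases h : NN i j
    · rw [if_pos h, if_pos (NN_symm _ _ h), mul_one, add_comm]
    · rw [if_neg h, if_neg (fun h' => h (NN_symm _ _ h'))]; ring
  · rw [if_neg h, if_neg h]
    split_ifs <;> ring

lemma multi_bound {L : ℕ} [NeZero L] (β ε : ℝ) (hβ : 0 < β) (hε : 0 < ε)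
    (γ : ℝ) (hγ0 : 0 < γ) (hγ1 : γ < 1) (n : ℕ) (x y : Fin n → Torus L) (hxy : ∀ j, NN (x j) (y j))
    (hinj : Function.Injective fun j => s(x j, y j)) :
    tsExpect β ε (fun t s => Real.exp (β * γ * ∑ j, (Bq t s (x j) (y j) - 1))) ≤
            ((1 - γ)⁻¹) ^ n := by
  have hg : 0 < 1 - γ := by linarith
  have hne : ∀ j, x j ≠ y j := fun j => (hxy j).1
  have hsym := Wt_symm NN NN_symm β γ x y
  have hnn := Wt_nonneg NN NN_symm β γ hβ hγ0 hγ1 x y hxy hinj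
  have hC : 0 ≤ ((1 - γ)⁻¹) ^ n := by positivity
  refine integral_le_of_lintegral _ _ _ hC ?_ ?_
  · intro p
    have h1 : 0 ≤ (Dmat β ε p.1).det := by
      rw [Dmat_eq β ε γ p.1 x y]
      exact (Dg_posDef _ ε p.1 (hsym ∅) (hnn ∅) hε).det_pos.le
    have hP : 0 < ∏ k, Real.exp (-p.1 k) := Finset.prod_pos fun i _ => Real.exp_pos _
    positivity
  · have hb := norm_bound (Wt NN β γ x y Finset.univ) ε (hsym _) (hnn _) hε
    refine le_trans ?_ ((mul_le_mul_right hb (ENNReal.ofReal (((1 - γ)⁻¹) ^ n))).trans (mul_one _).le)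
    rw [← lintegral_const_mul' _ _ ENNReal.ofReal_ne_top]
    refine lintegral_mono fun p => ?_
    simp only
    rw [← ENNReal.ofReal_mul hC]
    refine ENNReal.ofReal_le_ofReal ?_
    obtain ⟨t, s⟩ := p
    simp only
    have hd := det_Wt NN NN_symm β γ hβ hγ0 hγ1 x y hxy hinj hne ε hε t Finset.univ
    rw [← Dmat_eq, Finset.card_univ, Fintype.card_fin] at hd
    have hd2 : (Dmat β ε t).det ≤ ((1 - γ)⁻¹) ^ n * (Dg (Wt NN β γ x y Finset.univ) ε t).det := by
      rw [inv_pow, ← div_eq_inv_mul, le_div_iff₀ (by positivity), mul_comm]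
      exact hd
    have hs := Wt_sum NN β γ x y hne (fun a b => Bq t s a b - 1) (fun a b => by
      simp only [Bq]
      rw [← Real.cosh_neg, neg_sub, add_comm (t a)]; ring)
    have hE : Real.exp (β * γ * ∑ j, (Bq t s (x j) (y j) - 1)) * 
        Real.exp (-(β * nnSum (fun i j => Bq t s i j - 1)) - ε * ∑ k, (zb t s k - 1)) = 
        Real.exp (-((1/2) * ∑ i, ∑ j, Wt NN β γ x y Finset.univ i j * (Bq t s i j - 1)) - ε * ∑ k, (zb t s k - 1)) := by
      rw [← Real.exp_add, hs]
      congr 1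
      simp only [nnSum]
      ring
    have hP : 0 < ∏ k, Real.exp (-t k) := Finset.prod_pos fun i _ => Real.exp_pos _
    calc _ = (Dmat β ε t).det * (Real.exp (β * γ * ∑ j, (Bq t s (x j) (y j) - 1)) * 
        Real.exp (-(β * nnSum (fun i j => Bq t s i j - 1)) - ε * ∑ k, (zb t s k - 1))) * 
        (∏ k, Real.exp (-t k)) * ((2 * Real.pi)⁻¹) ^ (Fintype.card (Torus L)) := by ring
      _ ≤ (((1 - γ)⁻¹) ^ n * (Dg (Wt NN β γ x y Finset.univ) ε t).det) * (Real.exp (β * γ * ∑ j, (Bq t s (x j) (y j) - 1)) * 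
        Real.exp (-(β * nnSum (fun i j => Bq t s i j - 1)) - ε * ∑ k, (zb t s k - 1))) * 
        (∏ k, Real.exp (-t k)) * ((2 * Real.pi)⁻¹) ^ (Fintype.card (Torus L)) := by
          gcongr
      _ = _ := by
          rw [hE]
          simp only [Bq, zb]
          ring


/-- **Exponential bound on nearest-neighbor fluctuations.** For `0 < γ < 1`:
(i) for a nearest-neighbor pair `(x,y)`, `⟨e^{βγ(B_{xy}-1)}⟩ ≤ (1-γ)⁻¹`;
(ii) for `n` pairwise distinct nearest-neighbor pairs,
`⟨e^{βγ ∑ (B_{x_j y_j}-1)}⟩ ≤ (1-γ)⁻ⁿ`. -/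
theorem nn_fluctuation_exp_bound (β ε : ℝ) (hβ : 0 < β) (hε : 0 < ε) (L : ℕ)
    (γ : ℝ) (hγ0 : 0 < γ) (hγ1 : γ < 1) :
    (∀ x y : Torus (L + 2), NN x y →
        tsExpect β ε (fun t s => Real.exp (β * γ * (Bq t s x y - 1))) ≤ (1 - γ)⁻¹) ∧
      ∀ n : ℕ, ∀ x y : Fin n → Torus (L + 2), (∀ j, NN (x j) (y j)) →
        (Function.Injective fun j => s(x j, y j)) →
          tsExpect β ε (fun t s => Real.exp (β * γ * ∑ j, (Bq t s (x j) (y j) - 1))) ≤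
            ((1 - γ)⁻¹) ^ n := by
  have key := multi_bound (L := L + 2) β ε hβ hε γ hγ0 hγ1
  refine ⟨fun x y h => ?_, key⟩
  have := key 1 (fun _ => x) (fun _ => y) (fun _ => h) (Function.injective_of_subsingleton _)
  simpa using this

end
end

section
/- Large-deviation bound for nearest-neighbor fluctuations: for every β > 0, ε > 0, L ≥ 2, every δ > 0, every 0 < γ < 1, and every collection of n pairwise distinct nearest-neighbor pairs (x₁,y₁), …, (xₙ,yₙ), the (t,s)-expectation of the indicator of the event {B_{x_j y_j} > 1 + δ for all j = 1,…,n} is at most (1 − γ)^{-n} e^{−n βγ δ}. -/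
open scoped BigOperators Classical
open MeasureTheory

noncomputable section

variable {L : ℕ}

open Real Set in
lemma ld_gauss_lintegral : ∫⁻ v : ℝ, ENNReal.ofReal (rexp (-(v^2)/2)) = ENNReal.ofReal (√(2*π)) := by
  have h := integral_gaussian (1/2)
  have hi := integrable_exp_neg_mul_sq (b := 1/2) (by norm_num)
  have e : (fun v : ℝ => rexp (-(v^2)/2)) = fun v => rexp (-(1/2) * v^2) := by
    funext v; congr 1; ring
  rw [← ofReal_integral_eq_lintegral_ofReal (by rw [e]; exact hi)
    (Filter.Eventually.of_forall fun v => (exp_pos _).le), e, h]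
  congr 2; ring

open Real Set in
/-- derivative of `√y - c/√y`. -/
lemma ld_deriv_g (c y : ℝ) (hy : 0 < y) :
    HasDerivAt (fun y => √y - c / √y) (1/2 * (1/√y + c / (y * √y))) y := by
  have h1 := Real.hasDerivAt_sqrt hy.ne'
  have hs : 0 < √y := Real.sqrt_pos.2 hy
  have h2 := h1.sub ((h1.inv hs.ne').const_mul c)
  refine (h2.congr_deriv ?_).congr_of_eventuallyEq ?_
  · have : √y ^ 2 = y := Real.sq_sqrt hy.le
    rw [this]; field_simp; ring
  · exact Filter.Eventually.of_forall fun z => by simp [div_eq_mul_inv]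

open Real Set in
lemma ld_sq_g (c y : ℝ) (hy : 0 < y) : (√y - c / √y)^2 = y + c^2/y - 2*c := by
  have hs : 0 < √y := Real.sqrt_pos.2 hy
  have : √y ^ 2 = y := Real.sq_sqrt hy.le
  have e : c / √y * √y = c := by field_simp
  have e2 : (c/√y)^2 = c^2/y := by rw [div_pow, this]
  nlinarith

open Real Set in
lemma ld_scalar_aux1 (c : ℝ) (hc : 0 ≤ c) :
    ∫⁻ y in Ioi (0:ℝ), ENNReal.ofReal (1/2 * (1/√y + c / (y * √y)) * rexp (-(y + c^2/y - 2*c)/2))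
      = ∫⁻ v in (fun y => √y - c / √y) '' Ioi 0, ENNReal.ofReal (rexp (-(v^2)/2)) := by
  have hinj : InjOn (fun y => √y - c / √y) (Ioi 0) := by
    apply StrictMonoOn.injOn
    intro a ha b hb hab
    have ha' : 0 < √a := Real.sqrt_pos.2 ha
    have h1 : √a < √b := Real.sqrt_lt_sqrt (le_of_lt ha) hab
    have h2 : c / √b ≤ c / √a := by gcongr
    simp only; linarith
  rw [lintegral_image_eq_lintegral_abs_deriv_mul measurableSet_Ioi
    (fun y hy => (ld_deriv_g c y hy).hasDerivWithinAt) hinj]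
  refine setLIntegral_congr_fun measurableSet_Ioi fun y hy => ?_
  have hy : 0 < y := hy
  have hs : 0 < √y := Real.sqrt_pos.2 hy
  rw [ld_sq_g c y hy, abs_of_nonneg (by positivity), ENNReal.ofReal_mul (by positivity)]

open Real Set in
lemma ld_scalar_aux2 (c : ℝ) (hc : 0 < c) :
    ∫⁻ y in Ioi (0:ℝ), ENNReal.ofReal (1/√y * rexp (-(y + c^2/y - 2*c)/2))
      = ∫⁻ y in Ioi (0:ℝ), ENNReal.ofReal (c / (y * √y) * rexp (-(y + c^2/y - 2*c)/2)) := by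
  have him : (fun y => c^2 / y) '' Ioi (0:ℝ) = Ioi 0 := by
    ext z; constructor
    · rintro ⟨y, hy, rfl⟩
      have hy : 0 < y := hy
      show 0 < c^2/y; positivity
    · intro hz
      have hz : 0 < z := hz
      refine ⟨c^2/z, show 0 < c^2/z by positivity, ?_⟩
      simp only; field_simp
  have hinj : InjOn (fun y => c^2 / y) (Ioi (0:ℝ)) := by
    intro a ha b hb hab
    have ha : 0 < a := ha
    have hb : 0 < b := hb
    simp only at hab
    field_simp at hab
    linarith
  have hd : ∀ y ∈ Ioi (0:ℝ), HasDerivWithinAt (fun y => c^2 / y) (-(c^2 / y^2)) (Ioi 0) y := by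
    intro y hy
    have hy : 0 < y := hy
    have := ((hasDerivAt_inv hy.ne').const_mul (c^2)).hasDerivWithinAt (s := Ioi 0)
    refine (this.congr_deriv (by ring)).congr (fun z _ => by simp [div_eq_mul_inv]) (by simp [div_eq_mul_inv])
  conv_lhs => rw [← him]
  rw [lintegral_image_eq_lintegral_abs_deriv_mul measurableSet_Ioi hd hinj]
  refine setLIntegral_congr_fun measurableSet_Ioi fun y hy => ?_
  have hy : 0 < y := hy
  have hs : 0 < √y := Real.sqrt_pos.2 hy
  have h2 : √y ^ 2 = y := Real.sq_sqrt hy.le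
  rw [← ENNReal.ofReal_mul (abs_nonneg _), abs_neg, abs_of_nonneg (by positivity), ← mul_assoc]
  congr 2
  · rw [Real.sqrt_div (by positivity), Real.sqrt_sq hc.le]
    field_simp
    rw [h2]
  · congr 1; field_simp; ring

open Real Set in
lemma ld_scalar (c : ℝ) :
    ∫⁻ y in Ioi (0:ℝ), ENNReal.ofReal (1/√y * rexp (-(y + c^2/y)/2 + c))
      ≤ ENNReal.ofReal (√(2*π)) := by
  have key : ∀ c : ℝ, 0 ≤ c → ∫⁻ y in Ioi (0:ℝ), ENNReal.ofReal (1/√y * rexp (-(y + c^2/y - 2*c)/2))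
      ≤ ENNReal.ofReal (√(2*π)) := by
    intro c hc
    rcases hc.eq_or_lt with rfl | hc
    · have h0 := ld_scalar_aux1 0 le_rfl
      have him : (fun y => √y - 0 / √y) '' Ioi (0:ℝ) ⊆ Ioi 0 := by
        rintro _ ⟨y, hy, rfl⟩
        have : 0 < √y := Real.sqrt_pos.2 hy
        simpa using hy
      have hG := integral_gaussian_Ioi (1/2)
      have hi := (integrable_exp_neg_mul_sq (b := 1/2) (by norm_num)).integrableOn (s := Ioi 0)
      have e : (fun v : ℝ => rexp (-(v^2)/2)) = fun v => rexp (-(1/2) * v^2) := by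
        funext v; congr 1; ring
      have hG' : ∫⁻ v in Ioi (0:ℝ), ENNReal.ofReal (rexp (-(v^2)/2)) = ENNReal.ofReal (√(2*π)/2) := by
        rw [← ofReal_integral_eq_lintegral_ofReal (by rw [e]; exact hi)
          (Filter.Eventually.of_forall fun v => (exp_pos _).le), e, hG]
        congr 3; ring
      have e2 : ∀ y : ℝ, ENNReal.ofReal (1/√y * rexp (-(y + 0^2/y - 2*0)/2)) =
          2 * ENNReal.ofReal (1/2 * (1/√y + 0 / (y * √y)) * rexp (-(y + 0^2/y - 2*0)/2)) := by
        intro y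
        rw [← ENNReal.ofReal_ofNat 2, ← ENNReal.ofReal_mul (by norm_num)]
        congr 1; ring
      simp_rw [e2]
      rw [lintegral_const_mul' _ _ (by simp), h0]
      calc _ ≤ 2 * ∫⁻ v in Ioi (0:ℝ), ENNReal.ofReal (rexp (-(v^2)/2)) := by
            gcongr
        _ = _ := by
            rw [hG', ← ENNReal.ofReal_ofNat 2, ← ENNReal.ofReal_mul (by norm_num)]
            congr 1; ring
    · have h1 := ld_scalar_aux1 c hc.le
      have h2 := ld_scalar_aux2 c hc
      have hle : ∫⁻ v in (fun y => √y - c / √y) '' Ioi 0, ENNReal.ofReal (rexp (-(v^2)/2))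
          ≤ ENNReal.ofReal (√(2*π)) := by
        rw [← ld_gauss_lintegral]; exact setLIntegral_le_lintegral _ _
      rw [← h1] at hle
      have h3 : ∫⁻ y in Ioi (0:ℝ), ENNReal.ofReal (1/2 * (1/√y + c / (y * √y)) * rexp (-(y + c^2/y - 2*c)/2))
          = ENNReal.ofReal (1/2) * ((∫⁻ y in Ioi (0:ℝ), ENNReal.ofReal (1/√y * rexp (-(y + c^2/y - 2*c)/2))) +
            ∫⁻ y in Ioi (0:ℝ), ENNReal.ofReal (c / (y * √y) * rexp (-(y + c^2/y - 2*c)/2))) := by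
        rw [← lintegral_add_left (by fun_prop), ← lintegral_const_mul' _ _ (by simp)]
        refine setLIntegral_congr_fun measurableSet_Ioi fun y hy => ?_
        have hy : 0 < y := hy
        rw [← ENNReal.ofReal_add (by positivity) (by positivity), ← ENNReal.ofReal_mul (by norm_num)]
        congr 1; ring
      rw [h3, ← h2, ← two_mul, ← mul_assoc, ← ENNReal.ofReal_ofNat 2,
        ← ENNReal.ofReal_mul (by norm_num)] at hle
      norm_num at hle
      simpa using hle
  calc _ ≤ ∫⁻ y in Ioi (0:ℝ), ENNReal.ofReal (1/√y * rexp (-(y + |c|^2/y - 2*|c|)/2)) := by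
        apply lintegral_mono
        intro y
        apply ENNReal.ofReal_le_ofReal
        gcongr
        rw [sq_abs]
        have := le_abs_self c
        linarith
    _ ≤ _ := key _ (abs_nonneg c)
/-- The weight of the random Schroedinger operator `diagonal b + A`. -/
def ldPhi {ι : Type*} [Fintype ι] [DecidableEq ι] (A : Matrix ι ι ℝ) (η b : ι → ℝ) : ENNReal :=
  if (Matrix.diagonal b + A).PosDef then
    ENNReal.ofReal (Real.exp (-((1 : ι → ℝ) ⬝ᵥ (Matrix.diagonal b + A).mulVec 1) / 2
      - (η ⬝ᵥ (Matrix.diagonal b + A)⁻¹.mulVec η) / 2 + (1 : ι → ℝ) ⬝ᵥ η)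
      * (1 / √(Matrix.diagonal b + A).det)) else 0

open Matrix in
lemma ldPhi_equiv {α β : Type*} [Fintype α] [DecidableEq α] [Fintype β] [DecidableEq β] (e : α ≃ β)
    (A : Matrix β β ℝ) (η b : β → ℝ) :
    ldPhi A η b ≤ ldPhi (A.submatrix e e) (η ∘ e) (b ∘ e) := by
  unfold ldPhi
  have hH : diagonal (b ∘ e) + A.submatrix e e = (diagonal b + A).submatrix e e := by
    rw [← submatrix_diagonal_equiv]; rfl
  rw [hH]
  split_ifs with h1 h2
  · apply le_of_eq
    have h1' : (1 : α → ℝ) = (1 : β → ℝ) ∘ e := rfl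
    rw [inv_submatrix_equiv, det_submatrix_equiv_self, h1', submatrix_mulVec_equiv,
      submatrix_mulVec_equiv]
    simp only [Function.comp_assoc, Equiv.self_comp_symm, Function.comp_id,
      comp_equiv_dotProduct_comp_equiv]
  · exact absurd (h1.submatrix e.injective) h2
  · exact zero_le
  · exact zero_le

/-- The one-variable weight. -/
def ldScal (c y : ℝ) : ENNReal :=
  (Set.Ioi (0:ℝ)).indicator
    (fun y => ENNReal.ofReal (1/√y * Real.exp (-(y + c^2/y)/2 + c))) y

open Matrix in
lemma ldPhi_step {α : Type*} [Fintype α] [DecidableEq α]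
    (A : Matrix (α ⊕ Unit) (α ⊕ Unit) ℝ) (hA : A.IsSymm) (η : α ⊕ Unit → ℝ) (b₁ : α → ℝ) (b₀ : ℝ) :
    ldPhi A η (Sum.elim b₁ (fun _ => b₀)) ≤
      ldPhi A.toBlocks₁₁ (fun i => η (Sum.inl i) - A (Sum.inl i) (Sum.inr ())) b₁ *
      ldScal (η (Sum.inr ()) - (fun i => A (Sum.inl i) (Sum.inr ())) ⬝ᵥ
          (diagonal b₁ + A.toBlocks₁₁)⁻¹ *ᵥ (fun i => η (Sum.inl i)))
        (b₀ + (A (Sum.inr ()) (Sum.inr ()) - (fun i => A (Sum.inl i) (Sum.inr ())) ⬝ᵥ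
          (diagonal b₁ + A.toBlocks₁₁)⁻¹ *ᵥ (fun i => A (Sum.inl i) (Sum.inr ())))) := by
  set H₁ := diagonal b₁ + A.toBlocks₁₁ with hH₁
  set w : α → ℝ := fun i => A (Sum.inl i) (Sum.inr ()) with hw
  set a : ℝ := A (Sum.inr ()) (Sum.inr ())
  set η₁ : α → ℝ := fun i => η (Sum.inl i) with hη₁
  set η₀ : ℝ := η (Sum.inr ())
  set c : ℝ := η₀ - w ⬝ᵥ H₁⁻¹ *ᵥ η₁ with hc
  set y : ℝ := b₀ + (a - w ⬝ᵥ H₁⁻¹ *ᵥ w) with hy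
  set H := diagonal (Sum.elim b₁ (fun _ => b₀)) + A with hH
  have hη : η = Sum.elim η₁ (fun _ => η₀) := by
    ext i; rcases i with i | i <;> rfl
  have hblock : H = fromBlocks H₁ (replicateCol Unit w) (replicateRow Unit w)
      (of fun _ _ => b₀ + a) := by
    ext i j
    rcases i with i | i <;> rcases j with j | j
    · simp [hH, hH₁, toBlocks₁₁, diagonal_apply]
    · simp [hH, hw]
    · have := hA.apply (Sum.inl j) (Sum.inr i)
      simp [hH, hw, this]
    · simp [hH, a]
  by_cases hpos : H.PosDef
  swap
  · rw [ldPhi, if_neg hpos]; exact zero_le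
  have hpos₁ : H₁.PosDef := by
    have := hpos.submatrix (e := Sum.inl) Sum.inl_injective
    rw [hblock] at this
    exact this
  have hdet₁ := hpos₁.det_pos
  have hdet := hpos.det_pos
  have hu₁ : IsUnit H₁.det := hdet₁.ne'.isUnit
  have hu : IsUnit H.det := hdet.ne'.isUnit
  have hdeteq : H.det = H₁.det * y := by
    let _ := invertibleOfIsUnitDet H₁ hu₁
    rw [hblock, det_fromBlocks₁₁, invOf_eq_nonsing_inv]
    congr 1
    rw [det_unique]
    simp only [Matrix.sub_apply, of_apply, mul_apply, replicateRow_apply, replicateCol_apply, hy,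
      dotProduct, mulVec, Finset.sum_mul, Finset.mul_sum]
    rw [Finset.sum_comm]
    simp only [mul_assoc]
    ring
  have hy0 : 0 < y := by
    rw [hdeteq] at hdet
    exact (pos_iff_pos_of_mul_pos hdet).1 hdet₁
  have hsymm₁ : H₁⁻¹ᵀ = H₁⁻¹ := by
    rw [transpose_nonsing_inv]
    congr 1
    have := hpos₁.isHermitian
    simpa [IsHermitian] using this
  have hsw : η₁ ⬝ᵥ H₁⁻¹ *ᵥ w = w ⬝ᵥ H₁⁻¹ *ᵥ η₁ := by
    rw [dotProduct_mulVec, ← mulVec_transpose, hsymm₁, dotProduct_comm]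
  set z := c / y with hz
  have hv : H *ᵥ (Sum.elim (H₁⁻¹ *ᵥ (η₁ - z • w)) (fun _ => z)) = η := by
    rw [hblock, fromBlocks_mulVec, hη]
    congr 1
    · simp only [Sum.elim_comp_inl, Sum.elim_comp_inr, mulVec_mulVec, mul_nonsing_inv _ hu₁,
        one_mulVec]
      ext i
      simp [mulVec, dotProduct]
      ring
    · ext u
      simp only [Sum.elim_comp_inl, Sum.elim_comp_inr, Pi.add_apply]
      have e1 : (replicateRow Unit w *ᵥ H₁⁻¹ *ᵥ (η₁ - z • w)) u
          = w ⬝ᵥ H₁⁻¹ *ᵥ η₁ - z * (w ⬝ᵥ H₁⁻¹ *ᵥ w) := by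
        rw [mulVec_sub, mulVec_smul]
        show w ⬝ᵥ _ = _
        rw [dotProduct_sub, dotProduct_smul, smul_eq_mul]
      rw [e1]
      have e2 : ((of fun _ _ => b₀ + a : Matrix Unit Unit ℝ) *ᵥ fun _ => z) u = (b₀ + a) * z := by
        simp [mulVec, dotProduct]
      rw [e2]
      have : z * y = c := by rw [hz]; field_simp
      have h3 : η₀ = c + w ⬝ᵥ H₁⁻¹ *ᵥ η₁ := by rw [hc]; ring
      rw [h3, ← this, hy]; ring
  have hinv : H⁻¹ *ᵥ η = Sum.elim (H₁⁻¹ *ᵥ (η₁ - z • w)) (fun _ => z) := by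
    conv_lhs => rw [← hv, mulVec_mulVec, nonsing_inv_mul _ hu, one_mulVec]
  have hq : η ⬝ᵥ H⁻¹ *ᵥ η = η₁ ⬝ᵥ H₁⁻¹ *ᵥ η₁ + c^2 / y := by
    rw [hinv, hη, sumElim_dotProduct_sumElim, mulVec_sub, mulVec_smul, dotProduct_sub,
      dotProduct_smul, hsw, smul_eq_mul]
    have : ((fun _ => η₀ : Unit → ℝ) ⬝ᵥ fun _ => z) = η₀ * z := by simp [dotProduct]
    rw [this]
    have h3 : η₀ = c + w ⬝ᵥ H₁⁻¹ *ᵥ η₁ := by rw [hc]; ring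
    rw [h3, hz]; ring
  have h1 : (1 : α ⊕ Unit → ℝ) ⬝ᵥ H *ᵥ 1 = (1 : α → ℝ) ⬝ᵥ H₁ *ᵥ 1 + 2 * ((1 : α → ℝ) ⬝ᵥ w) + (b₀ + a) := by
    have e : (1 : α ⊕ Unit → ℝ) = Sum.elim (1 : α → ℝ) (1 : Unit → ℝ) := by
      ext i; rcases i with i | i <;> rfl
    rw [e, hblock, fromBlocks_mulVec, sumElim_dotProduct_sumElim]
    simp only [Sum.elim_comp_inl, Sum.elim_comp_inr, dotProduct_add]
    simp [mulVec, dotProduct]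
    ring
  have h2 : (1 : α ⊕ Unit → ℝ) ⬝ᵥ η = (1 : α → ℝ) ⬝ᵥ η₁ + η₀ := by
    simp [dotProduct, η₁, η₀]
  have h4 : (fun i => η₁ i - w i) = η₁ - w := rfl
  have h5 : (η₁ - w) ⬝ᵥ H₁⁻¹ *ᵥ (η₁ - w) = η₁ ⬝ᵥ H₁⁻¹ *ᵥ η₁ - 2 * (w ⬝ᵥ H₁⁻¹ *ᵥ η₁)
      + w ⬝ᵥ H₁⁻¹ *ᵥ w := by
    rw [mulVec_sub, sub_dotProduct, dotProduct_sub, dotProduct_sub, hsw]; ring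
  apply le_of_eq
  rw [ldPhi, if_pos hpos, ldPhi, if_pos hpos₁, ldScal, Set.indicator_of_mem (show y ∈ Set.Ioi 0 from hy0),
    ← ENNReal.ofReal_mul (by positivity), h4, h5]
  rw [hq, h1, h2, hdeteq, Real.sqrt_mul hdet₁.le]
  congr 1
  have e6 : ∀ p q r u : ℝ, p * (1 / q) * (1 / r * u) = (p * u) * (1 / (q * r)) := by
    intro p q r u; rw [one_div, one_div, one_div, mul_inv]; ring
  rw [e6, ← Real.exp_add]
  congr 2
  rw [dotProduct_sub, hy, hc]; ring

open Matrix in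
lemma ldScal_lintegral (c k : ℝ) :
    ∫⁻ b : Unit → ℝ, ldScal c (b () + k) ≤ ENNReal.ofReal (√(2 * Real.pi)) := by
  have h := (volume_preserving_funUnique Unit ℝ).lintegral_comp_emb
    (MeasurableEquiv.measurableEmbedding _) (fun b => ldScal c (b + k))
  have h' : ∫⁻ b : Unit → ℝ, ldScal c (b () + k) = ∫⁻ b : ℝ, ldScal c (b + k) := h
  rw [h', lintegral_add_right_eq_self (fun b => ldScal c b) k]
  unfold ldScal
  rw [lintegral_indicator measurableSet_Ioi]
  exact ld_scalar c

/-- The normalization bound for the index type `α`. -/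
def LdClaim (α : Type) [Fintype α] : Prop :=
  ∀ (_ : DecidableEq α) (A : Matrix α α ℝ), A.IsSymm →
    ∀ η : α → ℝ, ∫⁻ b, ldPhi A η b ≤ ENNReal.ofReal (√(2 * Real.pi)) ^ Fintype.card α

open Matrix in
lemma ldClaim_equiv {α β : Type} [Fintype α] [Fintype β] (e : α ≃ β) (hα : LdClaim α) :
    LdClaim β := by
  intro _ A hA η
  let dα : DecidableEq α := Classical.decEq α
  have h := (volume_measurePreserving_piCongrLeft (fun _ : β => ℝ) e).lintegral_comp_emb
    (MeasurableEquiv.measurableEmbedding _) (ldPhi A η)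
  rw [← h, ← Fintype.card_congr e]
  refine le_trans (lintegral_mono fun b => ?_) (hα dα (A.submatrix e e) (hA.submatrix e) (η ∘ e))
  refine (ldPhi_equiv e _ _ _).trans (le_of_eq ?_)
  congr 1
  ext i
  simp [MeasurableEquiv.piCongrLeft, Equiv.piCongrLeft_apply_apply]

open Matrix in
lemma ldClaim_sum {α : Type} [Fintype α] (hα : LdClaim α) : LdClaim (α ⊕ Unit) := by
  intro hd A hA η
  let dα : DecidableEq α := Classical.decEq α
  have hdd : hd = instDecidableEqSum := Subsingleton.elim _ _
  subst hdd
  have h := (volume_measurePreserving_sumPiEquivProdPi_symm (fun _ : α ⊕ Unit => ℝ)).lintegral_comp_emb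
    (MeasurableEquiv.measurableEmbedding _) (ldPhi A η)
  rw [← h]
  refine (lintegral_prod_le _).trans ?_
  have hcard : Fintype.card (α ⊕ Unit) = Fintype.card α + 1 := by simp
  rw [hcard, pow_succ]
  refine le_trans ?_ (mul_le_mul_left (hα dα A.toBlocks₁₁ ?_
    (fun i => η (Sum.inl i) - A (Sum.inl i) (Sum.inr ()))) _)
  · rw [← lintegral_mul_const' _ _ ENNReal.ofReal_ne_top]
    refine lintegral_mono fun b₁ => ?_
    obtain ⟨c, k, hle⟩ : ∃ c k : ℝ, ∀ b₀ : Unit → ℝ,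
        ldPhi A η ((MeasurableEquiv.sumPiEquivProdPi (fun _ : α ⊕ Unit => ℝ)).symm (b₁, b₀)) ≤
          ldPhi A.toBlocks₁₁ (fun i => η (Sum.inl i) - A (Sum.inl i) (Sum.inr ())) b₁ *
            ldScal c (b₀ () + k) := by
      refine ⟨_, _, fun b₀ => le_trans (le_of_eq ?_) (ldPhi_step A hA η b₁ (b₀ ()))⟩
      congr 1
    refine (lintegral_mono hle).trans ?_
    rw [lintegral_const_mul']
    · exact mul_le_mul_right (ldScal_lintegral _ _) _
    · unfold ldPhi; split_ifs <;> simp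
  · ext i j
    exact hA.apply _ _

open Matrix in
lemma ld_claim (ι : Type) [Fintype ι] : LdClaim ι := by
  refine Fintype.induction_empty_option (P := fun α [Fintype α] => LdClaim α) ?_ ?_ ?_ ι
  · intro α β hβ e hα
    let _ := Fintype.ofEquiv β e.symm
    exact ldClaim_equiv e (by convert hα)
  · intro _ A hA η
    rw [volume_pi, Measure.pi_of_empty _ (fun x => x.elim), lintegral_dirac]
    simp [ldPhi]
    split_ifs <;> simp
  · intro α _ hα
    exact ldClaim_equiv (Equiv.optionEquivSumPUnit α).symm (ldClaim_sum hα)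
open Matrix in
open scoped MatrixOrder in
lemma ld_exists_sq {ι : Type*} [Fintype ι] [DecidableEq ι] (D : Matrix ι ι ℝ) (hD : D.PosDef) :
    ∃ B : Matrix ι ι ℝ, D = Bᵀ * B := by
  obtain ⟨B, hB⟩ := CStarAlgebra.nonneg_iff_eq_star_mul_self.mp hD.posSemidef.nonneg
  refine ⟨B, ?_⟩
  rw [hB]; simp [star_eq_conjTranspose]

open Matrix in
lemma ld_gauss_pi {ι : Type*} [Fintype ι] :
    ∫⁻ u : ι → ℝ, ENNReal.ofReal (Real.exp (-(u ⬝ᵥ u) / 2))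
      = ENNReal.ofReal (√(2 * Real.pi)) ^ Fintype.card ι := by
  have e : ∀ u : ι → ℝ, Real.exp (-(u ⬝ᵥ u) / 2) = ∏ i, Real.exp (-(1/2) * (u i)^2) := by
    intro u
    rw [← Real.exp_sum]; congr 1
    rw [← Finset.mul_sum, dotProduct]
    have : ∑ i, u i * u i = ∑ i, u i ^ 2 := by simp [sq]
    rw [this]; ring
  simp_rw [e]
  have hi := integrable_exp_neg_mul_sq (b := 1/2) (by norm_num)
  rw [← ofReal_integral_eq_lintegral_ofReal]
  · rw [integral_fintype_prod_volume_eq_pow (fun v : ℝ => Real.exp (-(1/2) * v^2)), integral_gaussian,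
      ENNReal.ofReal_pow (by positivity)]
    congr 3; ring
  · exact Integrable.fintype_prod (fun _ => hi)
  · exact Filter.Eventually.of_forall fun u => Finset.prod_nonneg fun i _ => (Real.exp_pos _).le

open Matrix in
lemma ld_gauss {ι : Type*} [Fintype ι] [DecidableEq ι] (D : Matrix ι ι ℝ) (hD : D.PosDef) :
    ∫⁻ s : ι → ℝ, ENNReal.ofReal (Real.exp (-(s ⬝ᵥ D *ᵥ s) / 2))
      = ENNReal.ofReal (1 / √D.det) * ENNReal.ofReal (√(2 * Real.pi)) ^ Fintype.card ι := by
  obtain ⟨B, hB⟩ := ld_exists_sq D hD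
  have hdet : D.det = B.det ^ 2 := by rw [hB, det_mul, det_transpose, sq]
  have hB0 : B.det ≠ 0 := by
    intro h
    have := hD.det_pos
    rw [hdet, h] at this; simp at this
  have hq : ∀ s : ι → ℝ, s ⬝ᵥ D *ᵥ s = (toLin' B s) ⬝ᵥ (toLin' B s) := by
    intro s
    rw [hB, toLin'_apply, ← mulVec_mulVec, dotProduct_mulVec, vecMul_transpose]
  simp_rw [hq]
  have hm := Real.map_matrix_volume_pi_eq_smul_volume_pi hB0
  have hmeas : Measurable (fun u : ι → ℝ => ENNReal.ofReal (Real.exp (-(u ⬝ᵥ u) / 2))) := by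
    unfold dotProduct; fun_prop
  have hlin : Measurable (toLin' B) := (LinearMap.continuous_of_finiteDimensional _).measurable
  rw [← lintegral_map hmeas hlin, hm, lintegral_smul_measure, ld_gauss_pi, hdet, Real.sqrt_sq_eq_abs,
    abs_inv, one_div, smul_eq_mul]

/-- Weighted Laplacian. -/
def ldLap {ι : Type*} [Fintype ι] [DecidableEq ι] (W : Matrix ι ι ℝ) (t : ι → ℝ) : Matrix ι ι ℝ :=
  Matrix.diagonal (fun j => ∑ i, W i j * Real.exp (t i + t j))
    - Matrix.of fun j k => W j k * Real.exp (t j + t k)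

/-- Weighted Laplacian with mass. -/
def ldD {ι : Type*} [Fintype ι] [DecidableEq ι] (W : Matrix ι ι ℝ) (ε : ℝ) (t : ι → ℝ) :
    Matrix ι ι ℝ :=
  Matrix.diagonal (fun j => ε * Real.exp (t j)) + ldLap W t

open Matrix in
lemma ldLap_quad {ι : Type*} [Fintype ι] [DecidableEq ι] (W : Matrix ι ι ℝ) (hW : W.IsSymm)
    (t s : ι → ℝ) :
    s ⬝ᵥ ldLap W t *ᵥ s = 1/2 * ∑ i, ∑ j, W i j * (Real.exp (t i + t j) * (s i - s j)^2) := by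
  have h1 : s ⬝ᵥ ldLap W t *ᵥ s = (∑ j, ∑ i, W i j * Real.exp (t i + t j) * s j ^ 2)
      - ∑ i, ∑ j, W i j * Real.exp (t i + t j) * (s i * s j) := by
    rw [ldLap, sub_mulVec, dotProduct_sub]
    congr 1
    · simp only [dotProduct, mulVec_diagonal]
      refine Finset.sum_congr rfl fun j _ => ?_
      rw [Finset.sum_mul, Finset.mul_sum]
      exact Finset.sum_congr rfl fun i _ => by ring
    · simp only [dotProduct, mulVec, of_apply]
      refine Finset.sum_congr rfl fun j _ => ?_
      rw [Finset.mul_sum]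
      exact Finset.sum_congr rfl fun i _ => by ring
  have h2 : (∑ j, ∑ i, W i j * Real.exp (t i + t j) * s j ^ 2)
      = ∑ i, ∑ j, W i j * Real.exp (t i + t j) * s i ^ 2 := by
    refine Finset.sum_congr rfl fun j _ => Finset.sum_congr rfl fun i _ => ?_
    rw [hW.apply j i, add_comm (t i)]
  have h3 : (∑ j, ∑ i, W i j * Real.exp (t i + t j) * s j ^ 2)
      = ∑ i, ∑ j, W i j * Real.exp (t i + t j) * s j ^ 2 := Finset.sum_comm
  have h4 : ∑ i, ∑ j, W i j * (Real.exp (t i + t j) * (s i - s j)^2)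
      = (∑ i, ∑ j, W i j * Real.exp (t i + t j) * s i ^ 2)
        + (∑ i, ∑ j, W i j * Real.exp (t i + t j) * s j ^ 2)
        - 2 * ∑ i, ∑ j, W i j * Real.exp (t i + t j) * (s i * s j) := by
    simp only [Finset.mul_sum, ← Finset.sum_add_distrib, ← Finset.sum_sub_distrib]
    exact Finset.sum_congr rfl fun j _ => Finset.sum_congr rfl fun i _ => by ring
  rw [h1, h4, ← h2, ← h3]; ring

open Matrix in
lemma ldLap_isSymm {ι : Type*} [Fintype ι] [DecidableEq ι] (W : Matrix ι ι ℝ) (hW : W.IsSymm)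
    (t : ι → ℝ) : (ldLap W t).IsSymm := by
  unfold ldLap
  refine (isSymm_diagonal _).sub ?_
  ext i j
  simp [hW.apply i j, add_comm]

open Matrix in
lemma ldD_posDef {ι : Type*} [Fintype ι] [DecidableEq ι] (W : Matrix ι ι ℝ) (hW : W.IsSymm)
    (hW0 : ∀ i j, 0 ≤ W i j) (ε : ℝ) (hε : 0 < ε) (t : ι → ℝ) : (ldD W ε t).PosDef := by
  unfold ldD
  refine (PosDef.diagonal fun i => ?_).add_posSemidef ?_
  · have := Real.exp_pos (t i); positivity
  · refine PosSemidef.of_dotProduct_mulVec_nonneg ?_ fun s => ?_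
    · have := ldLap_isSymm W hW t
      simpa [IsHermitian, IsSymm] using this
    · rw [star_trivial, ldLap_quad W hW]
      have : ∀ i j, 0 ≤ W i j * (Real.exp (t i + t j) * (s i - s j)^2) := fun i j =>
        mul_nonneg (hW0 i j) (by positivity)
      have := Finset.sum_nonneg fun i (_ : i ∈ Finset.univ) =>
        Finset.sum_nonneg fun j (_ : j ∈ Finset.univ) => this i j
      linarith

open Matrix in
lemma ld_det_step {ι : Type*} [Fintype ι] [DecidableEq ι] (M : Matrix ι ι ℝ) (hM : M.PosDef)
    (v : ι → ℝ) (k γ : ℝ) (hγ : 0 ≤ γ) :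
    (1 - γ) * (M + k • vecMulVec v v).det ≤ (M + ((1 - γ) * k) • vecMulVec v v).det := by
  have h : ∀ k : ℝ, (M + k • vecMulVec v v).det = M.det * (1 + k * (v ⬝ᵥ M⁻¹ *ᵥ v)) := by
    intro k
    have h1 := det_add_replicateCol_mul_replicateRow (ι := Unit) hM.det_pos.ne'.isUnit (k • v) v
    have h2 : replicateCol Unit (k • v) * replicateRow Unit v = k • vecMulVec v v := by
      ext i j; simp [mul_apply, vecMulVec_apply]; ring
    rw [h2] at h1
    rw [h1]
    congr 1
    rw [det_unique]
    simp only [Matrix.add_apply, Matrix.one_apply_eq]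
    congr 1
    rw [Matrix.mul_assoc]
    simp only [mul_apply, replicateRow_apply, replicateCol_apply, dotProduct, mulVec, Finset.mul_sum,
      Pi.smul_apply, smul_eq_mul]
    exact Finset.sum_congr rfl fun j _ => Finset.sum_congr rfl fun i _ => by ring
  rw [h, h]
  have := mul_nonneg hγ hM.det_pos.le
  nlinarith
/-- The change of variables from `t` to the diagonal of the random Schroedinger operator. -/
def ldB {ι : Type*} [Fintype ι] (W : Matrix ι ι ℝ) (ε : ℝ) (t : ι → ℝ) : ι → ℝ :=
  fun i => ∑ j, W i j * Real.exp (t j - t i) + ε * Real.exp (-t i)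

open Matrix in
lemma ldH_eq {ι : Type*} [Fintype ι] [DecidableEq ι] (W : Matrix ι ι ℝ) (hW : W.IsSymm) (ε : ℝ)
    (t : ι → ℝ) : diagonal (ldB W ε t) + -W =
      diagonal (fun i => Real.exp (-t i)) * ldD W ε t * diagonal (fun i => Real.exp (-t i)) := by
  ext i j
  rw [mul_diagonal, diagonal_mul]
  have hij : Real.exp (-t i) * Real.exp (t i + t j) * Real.exp (-t j) = 1 := by
    rw [← Real.exp_add, ← Real.exp_add]; simp
  rcases eq_or_ne i j with rfl | h
  · simp only [ldD, ldLap, Matrix.add_apply, Matrix.sub_apply, diagonal_apply_eq, of_apply,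
      Matrix.neg_apply, ldB]
    have e1 : Real.exp (-t i) * Real.exp (t i) = 1 := by rw [← Real.exp_add]; simp
    have e2 : ∑ k, W i k * Real.exp (t k - t i)
        = Real.exp (-t i) * (∑ k, W k i * Real.exp (t k + t i)) * Real.exp (-t i) := by
      rw [Finset.mul_sum, Finset.sum_mul]
      refine Finset.sum_congr rfl fun k _ => ?_
      rw [hW.apply i k, sub_eq_add_neg, Real.exp_add, Real.exp_add]
      linear_combination (-W i k * Real.exp (t k) * Real.exp (-t i)) * e1
    rw [e2]
    linear_combination (-ε * Real.exp (-t i)) * e1 + W i i * hij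
  · simp only [ldD, ldLap, Matrix.add_apply, Matrix.sub_apply, diagonal_apply_ne _ h, of_apply,
      Matrix.neg_apply]
    linear_combination W i j * hij

open Matrix in
lemma ldH_posDef {ι : Type*} [Fintype ι] [DecidableEq ι] (W : Matrix ι ι ℝ) (hW : W.IsSymm)
    (hW0 : ∀ i j, 0 ≤ W i j) (ε : ℝ) (hε : 0 < ε) (t : ι → ℝ) :
    (diagonal (ldB W ε t) + -W).PosDef := by
  rw [ldH_eq W hW]
  have h := (ldD_posDef W hW hW0 ε hε t).conjTranspose_mul_mul_same
    (B := diagonal (fun i => Real.exp (-t i))) ?_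
  · simpa using h
  · intro u v huv
    ext i
    have := congrFun huv i
    simpa [mulVec_diagonal] using this

open Matrix in
lemma ldH_det {ι : Type*} [Fintype ι] [DecidableEq ι] (W : Matrix ι ι ℝ) (hW : W.IsSymm)
    (ε : ℝ) (t : ι → ℝ) :
    (diagonal (ldB W ε t) + -W).det = (∏ i, Real.exp (-t i))^2 * (ldD W ε t).det := by
  rw [ldH_eq W hW, det_mul, det_mul, det_diagonal]; ring

open Matrix in
lemma ldH_mulVec {ι : Type*} [Fintype ι] [DecidableEq ι] (W : Matrix ι ι ℝ)
    (ε : ℝ) (t : ι → ℝ) :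
    (diagonal (ldB W ε t) + -W) *ᵥ (fun i => Real.exp (t i)) = fun _ => ε := by
  ext i
  rw [add_mulVec, Pi.add_apply, mulVec_diagonal, neg_mulVec, Pi.neg_apply]
  simp only [ldB, mulVec, dotProduct, add_mul, Finset.sum_mul]
  have e1 : Real.exp (-t i) * Real.exp (t i) = 1 := by rw [← Real.exp_add]; simp
  have e2 : ∀ j, W i j * Real.exp (t j - t i) * Real.exp (t i) = W i j * Real.exp (t j) := by
    intro j; rw [mul_assoc, ← Real.exp_add]; simp
  simp only [e2, mul_assoc, e1]
  ring

open Matrix in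
lemma ldB_injective {ι : Type*} [Fintype ι] [DecidableEq ι] (W : Matrix ι ι ℝ) (hW : W.IsSymm)
    (hW0 : ∀ i j, 0 ≤ W i j) (ε : ℝ) (hε : 0 < ε) : Function.Injective (ldB W ε) := by
  intro t t' h
  have h1 := ldH_mulVec W ε t
  have h2 := ldH_mulVec W ε t'
  rw [← h, ← h1] at h2
  have hu := (ldH_posDef W hW hW0 ε hε t).isUnit
  have := mulVec_injective_of_isUnit hu h2
  ext i
  exact (Real.exp_injective (congrFun this i)).symm

/-- Jacobian matrix of `ldB`. -/
def ldJ {ι : Type*} [Fintype ι] [DecidableEq ι] (W : Matrix ι ι ℝ) (ε : ℝ) (t : ι → ℝ) :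
    Matrix ι ι ℝ :=
  -(Matrix.diagonal (fun i => Real.exp (-t i) * Real.exp (-t i)) * ldD W ε t)

open Matrix in
lemma ldB_hasFDerivAt {ι : Type*} [Fintype ι] [DecidableEq ι] (W : Matrix ι ι ℝ) (hW : W.IsSymm)
    (ε : ℝ) (t : ι → ℝ) :
    HasFDerivAt (ldB W ε) (LinearMap.toContinuousLinearMap (toLin' (ldJ W ε t))) t := by
  rw [hasFDerivAt_pi']
  intro i
  have hp : ∀ j, HasFDerivAt (fun t : ι → ℝ => t j) (ContinuousLinearMap.proj (R := ℝ) (φ := fun _ : ι => ℝ) j) t :=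
    fun j => hasFDerivAt_apply j t
  have h1 := (HasFDerivAt.fun_sum (u := Finset.univ) fun j _ =>
    (((hp j).sub (hp i)).exp.const_mul (W i j))).add ((hp i).neg.exp.const_mul ε)
  refine h1.congr_fderiv ?_
  ext v
  have e1 : Real.exp (-t i) * Real.exp (t i) = 1 := by rw [← Real.exp_add]; simp
  simp only [ldJ, ContinuousLinearMap.add_apply, ContinuousLinearMap.sum_apply,
    ContinuousLinearMap.smul_apply, ContinuousLinearMap.sub_apply, ContinuousLinearMap.neg_apply,
    ContinuousLinearMap.proj_apply, ContinuousLinearMap.comp_apply, smul_eq_mul,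
    LinearMap.coe_toContinuousLinearMap', toLin'_apply, neg_mulVec, Pi.neg_apply, Pi.sub_apply]
  rw [← mulVec_mulVec, mulVec_diagonal, ldD, add_mulVec, Pi.add_apply, mulVec_diagonal, ldLap,
    sub_mulVec, Pi.sub_apply, mulVec_diagonal]
  simp only [mulVec, dotProduct, of_apply]
  have e2 : ∑ j, W i j * (Real.exp (t j - t i) * (v j - v i)) =
      Real.exp (-t i) * Real.exp (-t i) * (∑ x, W i x * Real.exp (t i + t x) * v x) -
      Real.exp (-t i) * Real.exp (-t i) * ((∑ k, W k i * Real.exp (t k + t i)) * v i) := by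
    rw [Finset.sum_mul, Finset.mul_sum, Finset.mul_sum, ← Finset.sum_sub_distrib]
    refine Finset.sum_congr rfl fun k _ => ?_
    rw [hW.apply i k, sub_eq_add_neg, Real.exp_add, Real.exp_add, Real.exp_add]
    linear_combination (-W i k * Real.exp (t k) * Real.exp (-t i) * (v k - v i)) * e1
  rw [e2]
  linear_combination (ε * v i * Real.exp (-t i)) * e1

open Matrix in
lemma ldJ_det {ι : Type*} [Fintype ι] [DecidableEq ι] (W : Matrix ι ι ℝ) (hW : W.IsSymm)
    (hW0 : ∀ i j, 0 ≤ W i j) (ε : ℝ) (hε : 0 < ε) (t : ι → ℝ) :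
    |(LinearMap.toContinuousLinearMap (toLin' (ldJ W ε t))).det|
      = (∏ i, Real.exp (-t i))^2 * (ldD W ε t).det := by
  have hd := (ldD_posDef W hW hW0 ε hε t).det_pos
  have : (LinearMap.toContinuousLinearMap (toLin' (ldJ W ε t))).det = (ldJ W ε t).det := by
    rw [ContinuousLinearMap.det]
    exact LinearMap.det_toLin' _
  rw [this, ldJ, det_neg, det_mul, det_diagonal, abs_mul, abs_pow, abs_neg, abs_one, one_pow, one_mul,
    Finset.prod_mul_distrib, ← sq, abs_of_pos]
  have := Finset.prod_pos fun i (_ : i ∈ Finset.univ) => Real.exp_pos (-t i)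
  positivity

open Matrix in
lemma ld_weight {ι : Type*} [Fintype ι] [DecidableEq ι] (W : Matrix ι ι ℝ) (hW : W.IsSymm)
    (hW0 : ∀ i j, 0 ≤ W i j) (ε : ℝ) (hε : 0 < ε) (t : ι → ℝ) :
    ENNReal.ofReal ((ldD W ε t).det * Real.exp (-(1/2 * ∑ i, ∑ j, W i j * (Real.cosh (t i - t j) - 1))
        - ε * ∑ k, (Real.cosh (t k) - 1)) * ∏ k, Real.exp (-t k)) * ENNReal.ofReal (1 / √(ldD W ε t).det)
      = ENNReal.ofReal |(LinearMap.toContinuousLinearMap (toLin' (ldJ W ε t))).det| *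
        ldPhi (-W) (fun _ => ε) (ldB W ε t) := by
  have hd := (ldD_posDef W hW hW0 ε hε t).det_pos
  have hP := Finset.prod_pos fun i (_ : i ∈ Finset.univ) => Real.exp_pos (-t i)
  have hpos := ldH_posDef W hW hW0 ε hε t
  have hinv : (diagonal (ldB W ε t) + -W)⁻¹ *ᵥ (fun _ => ε) = fun i => Real.exp (t i) := by
    rw [← ldH_mulVec W ε t, mulVec_mulVec, nonsing_inv_mul _ hpos.det_pos.ne'.isUnit, one_mulVec]
  rw [ldJ_det W hW hW0 ε hε, ldPhi, if_pos hpos, hinv, ldH_det W hW, Real.sqrt_mul (by positivity),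
    Real.sqrt_sq hP.le, ← ENNReal.ofReal_mul (by positivity), ← ENNReal.ofReal_mul (by positivity)]
  set P := ∏ i, Real.exp (-t i) with hPdef
  set d := (ldD W ε t).det
  have hs : 0 < √d := Real.sqrt_pos.2 hd
  have hexp : -(1/2 * ∑ i, ∑ j, W i j * (Real.cosh (t i - t j) - 1))
        - ε * ∑ k, (Real.cosh (t k) - 1) =
      -((1 : ι → ℝ) ⬝ᵥ (diagonal (ldB W ε t) + -W) *ᵥ 1) / 2
        - ((fun _ => ε) ⬝ᵥ fun i => Real.exp (t i)) / 2 + (1 : ι → ℝ) ⬝ᵥ fun _ => ε := by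
    have h1 : (1 : ι → ℝ) ⬝ᵥ (diagonal (ldB W ε t) + -W) *ᵥ 1
        = (∑ i, ∑ j, W i j * (Real.exp (t j - t i) - 1)) + ε * ∑ i, Real.exp (- t i) := by
      have hdg : diagonal (ldB W ε t) *ᵥ 1 = ldB W ε t := by
        ext i; simp [mulVec_diagonal]
      rw [add_mulVec, dotProduct_add, neg_mulVec, dotProduct_neg, hdg]
      simp only [dotProduct, mulVec, Pi.one_apply, one_mul, mul_one, ldB,
        Finset.sum_add_distrib, Finset.mul_sum, mul_sub, Finset.sum_sub_distrib]
      ring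
    have h2 : (∑ i, ∑ j, W i j * (Real.exp (t i - t j) - 1))
        = ∑ i, ∑ j, W i j * (Real.exp (t j - t i) - 1) := by
      rw [Finset.sum_comm]
      refine Finset.sum_congr rfl fun i _ => Finset.sum_congr rfl fun j _ => ?_
      rw [hW.apply i j]
    have h3 : ∑ i, ∑ j, W i j * (Real.cosh (t i - t j) - 1)
        = 1/2 * ((∑ i, ∑ j, W i j * (Real.exp (t i - t j) - 1))
          + ∑ i, ∑ j, W i j * (Real.exp (t j - t i) - 1)) := by
      rw [← Finset.sum_add_distrib, Finset.mul_sum]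
      refine Finset.sum_congr rfl fun i _ => ?_
      rw [← Finset.sum_add_distrib, Finset.mul_sum]
      refine Finset.sum_congr rfl fun j _ => ?_
      rw [Real.cosh_eq, neg_sub]; ring
    have h4 : ∑ k, (Real.cosh (t k) - 1) =
        1/2 * (∑ k, Real.exp (t k)) + 1/2 * (∑ k, Real.exp (-t k)) - ∑ k : ι, 1 := by
      rw [Finset.mul_sum, Finset.mul_sum, ← Finset.sum_add_distrib, ← Finset.sum_sub_distrib]
      refine Finset.sum_congr rfl fun i _ => ?_
      rw [Real.cosh_eq]; ring
    have h5 : ((fun _ => ε) ⬝ᵥ fun i => Real.exp (t i)) = ε * ∑ k, Real.exp (t k) := by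
      rw [dotProduct, Finset.mul_sum]
    have h6 : (1 : ι → ℝ) ⬝ᵥ (fun _ => ε) = ε * ∑ k : ι, 1 := by
      simp [dotProduct, mul_comm]
    rw [h1, h3, h2, h4, h5, h6]; ring
  rw [hexp]
  congr 1
  have : √d * √d = d := Real.mul_self_sqrt hd.le
  field_simp

lemma ld_norm {ι : Type} [Fintype ι] [DecidableEq ι] (W : Matrix ι ι ℝ) (hW : W.IsSymm)
    (hW0 : ∀ i j, 0 ≤ W i j) (ε : ℝ) (hε : 0 < ε) :
    ∫⁻ p : (ι → ℝ) × (ι → ℝ), ENNReal.ofReal ((ldD W ε p.1).det *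
      Real.exp (-(1/2 * ∑ i, ∑ j, W i j * (Real.cosh (p.1 i - p.1 j)
          + (1 / 2) * (p.2 i - p.2 j) ^ 2 * Real.exp (p.1 i + p.1 j) - 1))
        - ε * ∑ k, (Real.cosh (p.1 k) + (1 / 2) * (p.2 k) ^ 2 * Real.exp (p.1 k) - 1)) *
      ∏ k, Real.exp (-p.1 k)) ≤ ENNReal.ofReal (2 * Real.pi) ^ Fintype.card ι := by
  refine (lintegral_prod_le _).trans ?_
  set C := ENNReal.ofReal (√(2 * Real.pi)) ^ Fintype.card ι with hC
  have hCtop : C ≠ ⊤ := by rw [hC]; exact ENNReal.pow_ne_top ENNReal.ofReal_ne_top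
  have hCC : ENNReal.ofReal (2 * Real.pi) ^ Fintype.card ι = C * C := by
    rw [hC, ← mul_pow, ← ENNReal.ofReal_mul (by positivity), Real.mul_self_sqrt (by positivity)]
  rw [hCC]
  have hinner : ∀ t : ι → ℝ, ∫⁻ s : ι → ℝ, ENNReal.ofReal ((ldD W ε t).det *
      Real.exp (-(1/2 * ∑ i, ∑ j, W i j * (Real.cosh (t i - t j)
          + (1 / 2) * (s i - s j) ^ 2 * Real.exp (t i + t j) - 1))
        - ε * ∑ k, (Real.cosh (t k) + (1 / 2) * (s k) ^ 2 * Real.exp (t k) - 1)) *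
      ∏ k, Real.exp (-t k)) =
      ENNReal.ofReal |(LinearMap.toContinuousLinearMap (Matrix.toLin' (ldJ W ε t))).det| *
        ldPhi (-W) (fun _ => ε) (ldB W ε t) * C := by
    intro t
    have hD := ldD_posDef W hW hW0 ε hε t
    have hd := hD.det_pos
    rw [← ld_weight W hW hW0 ε hε, mul_assoc, hC, ← ld_gauss _ hD, ← lintegral_const_mul' _ _ ENNReal.ofReal_ne_top]
    refine lintegral_congr fun s => ?_
    rw [← ENNReal.ofReal_mul (by positivity)]
    congr 1
    have e6 : ∀ d x P q : ℝ, d * x * P * q = d * (x * q) * P := by intros; ring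
    rw [e6, ← Real.exp_add]
    congr 3
    have hq : s ⬝ᵥ (ldD W ε t).mulVec s = ε * (∑ k, (s k)^2 * Real.exp (t k)) +
        1/2 * ∑ i, ∑ j, W i j * (Real.exp (t i + t j) * (s i - s j)^2) := by
      rw [ldD, Matrix.add_mulVec, dotProduct_add, ldLap_quad W hW]
      congr 1
      simp only [dotProduct, Matrix.mulVec_diagonal, Finset.mul_sum]
      exact Finset.sum_congr rfl fun i _ => by ring
    rw [hq]
    have h1 : ∑ i, ∑ j, W i j * (Real.cosh (t i - t j)
          + (1 / 2) * (s i - s j) ^ 2 * Real.exp (t i + t j) - 1) =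
        (∑ i, ∑ j, W i j * (Real.cosh (t i - t j) - 1)) +
        1/2 * ∑ i, ∑ j, W i j * (Real.exp (t i + t j) * (s i - s j)^2) := by
      rw [Finset.mul_sum, ← Finset.sum_add_distrib]
      refine Finset.sum_congr rfl fun i _ => ?_
      rw [Finset.mul_sum, ← Finset.sum_add_distrib]
      exact Finset.sum_congr rfl fun j _ => by ring
    have h2 : ∑ k, (Real.cosh (t k) + (1 / 2) * (s k) ^ 2 * Real.exp (t k) - 1) =
        (∑ k, (Real.cosh (t k) - 1)) + 1/2 * ∑ k, (s k)^2 * Real.exp (t k) := by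
      rw [Finset.mul_sum, ← Finset.sum_add_distrib]
      exact Finset.sum_congr rfl fun j _ => by ring
    rw [h1, h2]; ring
  simp only [hinner]
  rw [lintegral_mul_const' _ _ hCtop]
  refine mul_le_mul_left ?_ C
  have hcv := lintegral_image_eq_lintegral_abs_det_fderiv_mul (volume : Measure (ι → ℝ))
    MeasurableSet.univ (fun t _ => (ldB_hasFDerivAt W hW ε t).hasFDerivWithinAt)
    ((ldB_injective W hW hW0 ε hε).injOn) (ldPhi (-W) (fun _ => ε))
  rw [Measure.restrict_univ] at hcv
  rw [← hcv]
  exact (setLIntegral_le_lintegral _ _).trans (ld_claim ι _ (-W) hW.neg _)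

/-- Indicator matrix of an unordered pair. -/
def ldE {ι : Type*} (a b : ι) : Matrix ι ι ℝ :=
  Matrix.of fun i j => if s(i, j) = s(a, b) then 1 else 0

lemma ldE_eq {ι : Type*} {a b : ι} (hab : a ≠ b) (i j : ι) :
    ldE a b i j = (if i = a then (if j = b then 1 else 0) else 0)
      + (if i = b then (if j = a then 1 else 0) else 0) := by
  simp only [ldE, Matrix.of_apply, Sym2.eq_iff]
  by_cases h1 : i = a
  · subst h1
    simp [hab]
  · by_cases h2 : i = b
    · subst h2
      simp [h1]
    · simp [h1, h2]

lemma ldE_symm {ι : Type*} (a b : ι) : (ldE a b).IsSymm := by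
  ext i j
  simp only [ldE, Matrix.transpose_apply, Matrix.of_apply, Sym2.eq_swap (a := i)]

lemma ldE_nonneg {ι : Type*} (a b i j : ι) : 0 ≤ ldE a b i j := by
  simp only [ldE, Matrix.of_apply]
  split_ifs <;> norm_num

lemma ldE_sum {ι : Type*} [Fintype ι] {a b : ι} (hab : a ≠ b) (f : ι → ι → ℝ) :
    ∑ i, ∑ j, ldE a b i j * f i j = f a b + f b a := by
  simp only [ldE_eq hab, add_mul, Finset.sum_add_distrib, ite_mul, zero_mul, one_mul]
  congr 1
  · rw [Finset.sum_eq_single a (fun i _ h => by simp [h]) (by simp)]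
    simp
  · rw [Finset.sum_eq_single b (fun i _ h => by simp [h]) (by simp)]
    simp

lemma ldD_add {ι : Type*} [Fintype ι] [DecidableEq ι] (W W2 : Matrix ι ι ℝ) (ε : ℝ) (t : ι → ℝ) :
    ldD (W + W2) ε t = ldD W ε t + ldLap W2 t := by
  have : ldLap (W + W2) t = ldLap W t + ldLap W2 t := by
    ext j k
    by_cases h : j = k
    · subst h
      simp [ldLap, add_mul, Finset.sum_add_distrib]; ring
    · simp [ldLap, h, add_mul]; ring
  rw [ldD, this, ldD, add_assoc]

lemma ldLap_E {ι : Type*} [Fintype ι] [DecidableEq ι] {a b : ι} (hab : a ≠ b) (c : ℝ) (t : ι → ℝ) :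
    ldLap (c • ldE a b) t = (c * Real.exp (t a + t b)) •
      Matrix.vecMulVec (fun i => (if i = a then 1 else 0) - (if i = b then 1 else 0))
        (fun i => (if i = a then 1 else 0) - (if i = b then (1:ℝ) else 0)) := by
  have hs : ∀ j, ∑ i, (c • ldE a b) i j * Real.exp (t i + t j) =
      c * Real.exp (t a + t b) * ((if j = a then 1 else 0) + (if j = b then 1 else 0)) := by
    intro j
    simp only [Matrix.smul_apply, ldE_eq hab, smul_eq_mul, mul_add, add_mul, Finset.sum_add_distrib,
      ite_mul, zero_mul, one_mul, mul_ite, mul_zero, mul_one, Finset.sum_ite_eq', Finset.mem_univ, if_true]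
    rw [add_comm]
    congr 1
    · split_ifs with h
      · rw [h, add_comm (t b)]
      · rfl
    · split_ifs with h
      · rw [h]
      · rfl
  ext j k
  rw [ldLap]
  simp only [hs]
  simp only [Matrix.sub_apply, Matrix.diagonal_apply, Matrix.of_apply, Matrix.smul_apply,
    Matrix.vecMulVec_apply, smul_eq_mul, ldE_eq hab]
  by_cases h1 : j = a
  · subst h1
    by_cases h2 : k = j
    · subst h2; simp [hab]
    · by_cases h3 : k = b
      · subst h3; simp [hab, hab.symm]
      · simp [h2, h3, Ne.symm h2]
  · by_cases h4 : j = b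
    · subst h4
      by_cases h2 : k = j
      · subst h2; simp [h1]
      · by_cases h3 : k = a
        · subst h3; simp [h1, h2]; left; ring
        · simp [h2, h3, Ne.symm h2]
    · simp [h1, h4]

/-- Reduced weights. -/
def ldW {ι κ : Type*} (A : Matrix ι ι ℝ) (c : ℝ) (x y : κ → ι) (K : Finset κ) : Matrix ι ι ℝ :=
  A - c • ∑ k ∈ K, ldE (x k) (y k)

lemma ldW_symm {ι κ : Type*} (A : Matrix ι ι ℝ) (hA : A.IsSymm) (c : ℝ) (x y : κ → ι)
    (K : Finset κ) : (ldW A c x y K).IsSymm := by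
  refine hA.sub (Matrix.IsSymm.smul ?_ c)
  ext i j
  rw [Matrix.transpose_apply, Matrix.sum_apply, Matrix.sum_apply]
  exact Finset.sum_congr rfl fun k _ => (ldE_symm (x k) (y k)).apply i j

lemma ldW_nonneg {ι κ : Type*} [Fintype κ] (A : Matrix ι ι ℝ) (β c : ℝ) (hc0 : 0 ≤ c)
    (hc : c ≤ β) (x y : κ → ι)
    (hA0 : ∀ i j, β * ∑ k, ldE (x k) (y k) i j ≤ A i j)
    (K : Finset κ) (i j : ι) : 0 ≤ ldW A c x y K i j := by
  have h1 := hA0 i j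
  have h2 : ∑ k ∈ K, ldE (x k) (y k) i j ≤ ∑ k, ldE (x k) (y k) i j :=
    Finset.sum_le_sum_of_subset_of_nonneg (Finset.subset_univ _) fun k _ _ => ldE_nonneg _ _ _ _
  have h3 : 0 ≤ ∑ k ∈ K, ldE (x k) (y k) i j := Finset.sum_nonneg fun k _ => ldE_nonneg _ _ _ _
  simp only [ldW, Matrix.sub_apply, Matrix.smul_apply, Matrix.sum_apply, smul_eq_mul]
  nlinarith

lemma ld_det_ind {ι κ : Type*} [Fintype ι] [DecidableEq ι] [Fintype κ] (A : Matrix ι ι ℝ)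
    (hA : A.IsSymm) (β γ ε : ℝ) (hβ : 0 ≤ β) (hγ0 : 0 ≤ γ) (hγ1 : γ ≤ 1) (hε : 0 < ε) (x y : κ → ι)
    (hxy : ∀ k, x k ≠ y k)
    (hA0 : ∀ i j, β * ∑ k, ldE (x k) (y k) i j ≤ A i j) (t : ι → ℝ) (K : Finset κ) :
    (1 - γ) ^ K.card * (ldD A ε t).det ≤ (ldD (ldW A (β * γ) x y K) ε t).det := by
  induction K using Finset.induction_on with
  | empty => simp [ldW]
  | insert k K hk ih =>
    rw [Finset.card_insert_of_notMem hk, pow_succ', mul_assoc]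
    refine (mul_le_mul_of_nonneg_left ih (by linarith)).trans ?_
    set V := ldW A (β * γ) x y K - β • ldE (x k) (y k) with hV
    have hVs : V.IsSymm := (ldW_symm A hA _ x y K).sub ((ldE_symm _ _).smul _)
    have hV0 : ∀ i j, 0 ≤ V i j := by
      intro i j
      have h := ldW_nonneg A β β hβ le_rfl x y hA0 (insert k K) i j
      have h3 : 0 ≤ ∑ k ∈ K, ldE (x k) (y k) i j := Finset.sum_nonneg fun k _ => ldE_nonneg _ _ _ _
      simp only [hV, ldW, Matrix.sub_apply, Matrix.smul_apply, Matrix.sum_apply, smul_eq_mul,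
        Finset.sum_insert hk, Matrix.add_apply] at h ⊢
      nlinarith [mul_nonneg (mul_nonneg hβ h3) (sub_nonneg.2 hγ1)]
    have e1 : ldW A (β * γ) x y K = V + β • ldE (x k) (y k) := by rw [hV]; abel
    have e2 : ldW A (β * γ) x y (insert k K) = V + ((1 - γ) * β) • ldE (x k) (y k) := by
      rw [hV, ldW, ldW, Finset.sum_insert hk]; module
    rw [e1, e2, ldD_add, ldD_add, ldLap_E (hxy k), ldLap_E (hxy k), mul_assoc (1 - γ) β]
    exact ld_det_step _ (ldD_posDef V hVs hV0 ε hε t) _ _ _ hγ0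

lemma ldNN_symm {L : ℕ} {x y : Torus L} (h : NN x y) : NN y x := by
  obtain ⟨h1, i, h2⟩ := h
  refine ⟨h1.symm, i, ?_⟩
  rcases h2 with h | h
  · right; rw [h]; abel
  · left; rw [h]; abel

/-- Base weights. -/
def ldA (L : ℕ) (β : ℝ) : Matrix (Torus L) (Torus L) ℝ :=
  Matrix.of fun i j => if NN i j then β else 0

lemma ldA_symm (L : ℕ) (β : ℝ) : (ldA L β).IsSymm := by
  ext i j
  simp only [ldA, Matrix.transpose_apply, Matrix.of_apply]
  congr 1
  exact propext ⟨ldNN_symm, ldNN_symm⟩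

lemma ldA_ge {L n : ℕ} (β : ℝ) (hβ : 0 < β) (x y : Fin n → Torus L) (hNN : ∀ j, NN (x j) (y j))
    (hd : Function.Injective fun j => s(x j, y j)) (i j : Torus L) :
    β * ∑ k, ldE (x k) (y k) i j ≤ ldA L β i j := by
  have h : ∑ k, ldE (x k) (y k) i j ≤ if NN i j then 1 else 0 := by
    simp only [ldE, Matrix.of_apply]
    split_ifs with hn
    · have hb := Finset.sum_boole (R := ℝ) (fun k => s(i, j) = s(x k, y k)) Finset.univ
      refine (le_of_eq (Eq.trans ?_ hb)).trans ?_
      · exact Finset.sum_congr rfl fun k _ => by congr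
      have : (Finset.univ.filter fun k => s(i, j) = s(x k, y k)).card ≤ 1 := by
        rw [Finset.card_le_one]
        intro a ha b hb
        simp only [Finset.mem_filter] at ha hb
        exact hd (ha.2.symm.trans hb.2)
      exact_mod_cast this
    · refine le_of_eq (Finset.sum_eq_zero fun k _ => if_neg fun h => hn ?_)
      rcases Sym2.eq_iff.1 h with ⟨rfl, rfl⟩ | ⟨rfl, rfl⟩
      · exact hNN k
      · exact ldNN_symm (hNN k)
  have := mul_le_mul_of_nonneg_left h hβ.le
  refine this.trans (le_of_eq ?_)
  simp [ldA]

lemma ldDmat {L : ℕ} [NeZero L] (β ε : ℝ) (t : Torus L → ℝ) : Dmat β ε t = ldD (ldA L β) ε t := by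
  ext j k
  by_cases h : j = k
  · subst h
    have : ¬ NN j j := fun h => h.1 rfl
    simp [Dmat, ldD, ldLap, ldA, this, Finset.mul_sum]
    ring
  · simp [Dmat, ldD, ldLap, ldA, h]
    split_ifs <;> simp

lemma ldBq_symm {L : ℕ} (t s : Torus L → ℝ) (i j : Torus L) : Bq t s i j = Bq t s j i := by
  unfold Bq
  rw [← Real.cosh_neg, add_comm (t i)]
  ring_nf

lemma ld_expo {L n : ℕ} [NeZero L] (β γ : ℝ) (x y : Fin n → Torus L) (hNN : ∀ j, NN (x j) (y j))
    (t s : Torus L → ℝ) :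
    β * nnSum (fun i j => Bq t s i j - 1) =
      1 / 2 * (∑ i, ∑ j, ldW (ldA L β) (β * γ) x y Finset.univ i j * (Bq t s i j - 1))
        + β * γ * ∑ k, (Bq t s (x k) (y k) - 1) := by
  have h1 : ∑ i, ∑ j, ldW (ldA L β) (β * γ) x y Finset.univ i j * (Bq t s i j - 1) =
      (∑ i, ∑ j, ldA L β i j * (Bq t s i j - 1)) -
        β * γ * ∑ k, ∑ i, ∑ j, ldE (x k) (y k) i j * (Bq t s i j - 1) := by
    have : ∑ k, ∑ i, ∑ j, ldE (x k) (y k) i j * (Bq t s i j - 1) =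
        ∑ i, ∑ j, (∑ k, ldE (x k) (y k) i j) * (Bq t s i j - 1) := by
      rw [Finset.sum_comm]
      refine Finset.sum_congr rfl fun i _ => ?_
      rw [Finset.sum_comm]
      exact Finset.sum_congr rfl fun j _ => (Finset.sum_mul _ _ _).symm
    rw [this]
    simp only [ldW, Matrix.sub_apply, Matrix.smul_apply, Matrix.sum_apply, smul_eq_mul, sub_mul,
      Finset.sum_sub_distrib]
    simp only [mul_assoc, Finset.mul_sum (Finset.univ : Finset (Torus L))]
  have h2 : ∑ k, ∑ i, ∑ j, ldE (x k) (y k) i j * (Bq t s i j - 1) =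
      2 * ∑ k, (Bq t s (x k) (y k) - 1) := by
    rw [Finset.mul_sum]
    refine Finset.sum_congr rfl fun k _ => ?_
    rw [ldE_sum (hNN k).1 fun i j => Bq t s i j - 1, ldBq_symm t s (y k)]; ring
  have h3 : ∑ i, ∑ j, ldA L β i j * (Bq t s i j - 1) =
      β * ∑ i, ∑ j, if NN i j then Bq t s i j - 1 else 0 := by
    simp only [Finset.mul_sum]
    refine Finset.sum_congr rfl fun i _ => Finset.sum_congr rfl fun j _ => ?_
    simp only [ldA, Matrix.of_apply]
    split_ifs <;> simp
  rw [h1, h2, h3, nnSum]; ring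

lemma ld_pointwise {L n : ℕ} [NeZero L] (β ε : ℝ) (hβ : 0 < β) (hε : 0 < ε)
    (δ : ℝ) (γ : ℝ) (hγ0 : 0 < γ) (hγ1 : γ < 1)
    (x y : Fin n → Torus L) (hNN : ∀ j, NN (x j) (y j))
    (hd : Function.Injective fun j => s(x j, y j)) (t s : Torus L → ℝ) :
    (if ∀ j : Fin n, 1 + δ < Bq t s (x j) (y j) then (1 : ℝ) else 0) * (Dmat β ε t).det *
      Real.exp (-(β * nnSum (fun i j => Bq t s i j - 1))
        - ε * ∑ k : Torus L, (zb t s k - 1)) *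
      (∏ k : Torus L, Real.exp (-(t k))) * ((2 * Real.pi)⁻¹) ^ (Fintype.card (Torus L)) ≤
    (((1 - γ)⁻¹) ^ n * Real.exp (-(n * (β * γ) * δ)) * ((2 * Real.pi)⁻¹) ^ (Fintype.card (Torus L))) *
      ((ldD (ldW (ldA L β) (β * γ) x y Finset.univ) ε t).det * Real.exp (-(1/2 * ∑ i, ∑ j,
        ldW (ldA L β) (β * γ) x y Finset.univ i j * (Real.cosh (t i - t j)
          + (1/2)*(s i - s j)^2 * Real.exp (t i + t j) - 1))
        - ε * ∑ k, (Real.cosh (t k) + (1/2)*(s k)^2*Real.exp (t k) - 1)) *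
        ∏ k, Real.exp (-t k)) := by
  have hg : 0 < 1 - γ := by linarith
  have hA0 := ldA_ge β hβ x y hNN hd
  have hdet := ld_det_ind (ldA L β) (ldA_symm L β) β γ ε hβ.le hγ0.le hγ1.le hε x y
    (fun k => (hNN k).1) hA0 t Finset.univ
  have hpd := (ldD_posDef _ (ldW_symm (ldA L β) (ldA_symm L β) (β * γ) x y Finset.univ)
    (ldW_nonneg (ldA L β) β (β * γ) (by positivity) (by nlinarith) x y hA0 Finset.univ) ε hε t).det_pos
  rw [Finset.card_univ, Fintype.card_fin] at hdet
  set d1 := (ldD (ldW (ldA L β) (β * γ) x y Finset.univ) ε t).det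
  set P := ∏ k : Torus L, Real.exp (-(t k))
  have hP : 0 < P := Finset.prod_pos fun i _ => Real.exp_pos _
  set N := Fintype.card (Torus L)
  have hpi := Real.pi_pos
  split_ifs with hev
  · rw [ldDmat, ld_expo β γ x y hNN]
    set S := 1 / 2 * (∑ i, ∑ j, ldW (ldA L β) (β * γ) x y Finset.univ i j * (Bq t s i j - 1)) with hS
    set Z := ε * ∑ k : Torus L, (zb t s k - 1) with hZ
    have hdet2 : (ldD (ldA L β) ε t).det ≤ ((1 - γ)⁻¹) ^ n * d1 := by
      rw [inv_pow, ← div_eq_inv_mul, le_div_iff₀ (by positivity), mul_comm]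
      exact hdet
    have hsum : n * δ ≤ ∑ k, (Bq t s (x k) (y k) - 1) := by
      have := Finset.sum_le_sum fun k (_ : k ∈ Finset.univ) =>
        (show δ ≤ Bq t s (x k) (y k) - 1 by linarith [hev k])
      simpa using this
    have hexp : Real.exp (-(S + β * γ * ∑ k, (Bq t s (x k) (y k) - 1)) - Z) ≤
        Real.exp (-(n * (β * γ) * δ)) * Real.exp (-S - Z) := by
      rw [← Real.exp_add]
      refine Real.exp_le_exp.2 ?_
      have := mul_le_mul_of_nonneg_left hsum (by positivity : 0 ≤ β * γ)
      linarith
    have := mul_le_mul hdet2 hexp (Real.exp_pos _).le (by positivity)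
    have h2 : 0 ≤ P * ((2 * Real.pi)⁻¹) ^ N := by positivity
    have h3 := mul_le_mul_of_nonneg_right this h2
    change _ ≤ _ * (d1 * Real.exp (-S - Z) * P)
    calc _ = (ldD (ldA L β) ε t).det * Real.exp (-(S + β * γ * ∑ k, (Bq t s (x k) (y k) - 1)) - Z)
          * (P * ((2 * Real.pi)⁻¹) ^ N) := by ring
      _ ≤ _ := h3
      _ = _ := by ring
  · simp only [zero_mul]
    positivity

theorem ld_main {L : ℕ} [NeZero L] (β ε : ℝ) (hβ : 0 < β) (hε : 0 < ε)
    (δ : ℝ) (γ : ℝ) (hγ0 : 0 < γ) (hγ1 : γ < 1)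
    (n : ℕ) (x y : Fin n → Torus L) (hNN : ∀ j, NN (x j) (y j))
    (hdistinct : Function.Injective fun j => s(x j, y j)) :
    tsExpect β ε
        (fun t s => if ∀ j : Fin n, 1 + δ < Bq t s (x j) (y j) then (1 : ℝ) else 0) ≤
      ((1 - γ)⁻¹) ^ n * Real.exp (-(n * (β * γ) * δ)) := by
  have hg : 0 < 1 - γ := by linarith
  have hpi := Real.pi_pos
  have hA0 := ldA_ge β hβ x y hNN hdistinct
  have hn := ld_norm _ (ldW_symm (ldA L β) (ldA_symm L β) (β * γ) x y Finset.univ)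
    (ldW_nonneg (ldA L β) β (β * γ) (by positivity) (by nlinarith) x y hA0 Finset.univ) ε hε
  have hC : 0 ≤ ((1 - γ)⁻¹) ^ n * Real.exp (-(n * (β * γ) * δ)) := by positivity
  have hD : 0 ≤ ((2 * Real.pi)⁻¹) ^ (Fintype.card (Torus L)) := by positivity
  unfold tsExpect
  by_cases hI : Integrable (fun p : (Torus L → ℝ) × (Torus L → ℝ) =>
    (if ∀ j : Fin n, 1 + δ < Bq p.1 p.2 (x j) (y j) then (1 : ℝ) else 0) * (Dmat β ε p.1).det *
      Real.exp (-(β * nnSum (fun i j => Bq p.1 p.2 i j - 1))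
        - ε * ∑ k, (zb p.1 p.2 k - 1)) *
      (∏ k, Real.exp (-(p.1 k))) * ((2 * Real.pi)⁻¹) ^ (Fintype.card (Torus L)))
  swap
  · rw [integral_undef hI]; exact hC
  rw [← ENNReal.ofReal_le_ofReal_iff hC]
  rw [ofReal_integral_eq_lintegral_ofReal hI]
  swap
  · refine Filter.Eventually.of_forall fun p => ?_
    have hdp : 0 < (Dmat β ε p.1).det := by
      rw [ldDmat]
      refine (ldD_posDef _ (ldA_symm _ _) (fun i j => ?_) ε hε p.1).det_pos
      simp only [ldA, Matrix.of_apply]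
      split_ifs <;> simp [hβ.le]
    have hP : 0 < ∏ k, Real.exp (-(p.1 k)) := Finset.prod_pos fun i _ => Real.exp_pos _
    have hi : (0:ℝ) ≤ if ∀ j : Fin n, 1 + δ < Bq p.1 p.2 (x j) (y j) then (1 : ℝ) else 0 := by
      split_ifs <;> norm_num
    exact mul_nonneg (mul_nonneg (mul_nonneg (mul_nonneg hi hdp.le) (Real.exp_pos _).le) hP.le) hD
  have hpt := fun p : (Torus L → ℝ) × (Torus L → ℝ) => ENNReal.ofReal_le_ofReal
    (ld_pointwise β ε hβ hε δ γ hγ0 hγ1 x y hNN hdistinct p.1 p.2)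
  have hmono := lintegral_mono (μ := volume) hpt
  refine le_trans hmono ?_
  clear hmono hpt
  simp only [ENNReal.ofReal_mul (mul_nonneg hC hD)]
  rw [lintegral_const_mul' _ _ ENNReal.ofReal_ne_top]
  refine (mul_le_mul_right hn _).trans (le_of_eq ?_)
  rw [← ENNReal.ofReal_pow (by positivity), ← ENNReal.ofReal_mul (mul_nonneg hC hD), mul_assoc,
    ← mul_pow, inv_mul_cancel₀ (by positivity), one_pow, mul_one]

/-- **Large-deviation bound for nearest-neighbor fluctuations.** For every `δ > 0`,
`0 < γ < 1` and `n` pairwise distinct nearest-neighbor pairs, the expectation of the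
indicator of `{B_{x_j y_j} > 1 + δ for all j}` is at most `(1-γ)⁻ⁿ e^{-nβγδ}`. -/
theorem nn_large_deviation (β ε : ℝ) (hβ : 0 < β) (hε : 0 < ε) (L : ℕ)
    (δ : ℝ) (hδ : 0 < δ) (γ : ℝ) (hγ0 : 0 < γ) (hγ1 : γ < 1)
    (n : ℕ) (x y : Fin n → Torus (L + 2)) (hNN : ∀ j, NN (x j) (y j))
    (hdistinct : Function.Injective fun j => s(x j, y j)) :
    tsExpect β ε
        (fun t s => if ∀ j : Fin n, 1 + δ < Bq t s (x j) (y j) then (1 : ℝ) else 0) ≤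
      ((1 - γ)⁻¹) ^ n * Real.exp (-(n * (β * γ) * δ)) := by
  exact ld_main β ε hβ hε δ γ hγ0 hγ1 n x y hNN hdistinct

end
end
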